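/- arXiv:2211.08145 — 3 statements merged into one kernel-verified Lean document; each statement's English description precedes it below -/
import Mathlib

section
/- Let G be a finitely generated group with the strong topological Rokhlin property, and fix a compatible metric on the Cantor space 𝒞. Then the set {α ∈ Act_G(𝒞) : the action α has shadowing} is comeager in Act_G(𝒞); in particular, shadowing is generic for continuous actions of G on the Cantor space. -/
open Topology

/-- The Cantor space `𝒞`. -/
abbrev Cantor : Type := ℕ → Bool

/-- `α : G → C(𝒞,𝒞)` is a continuous action if it is a homomorphism into the
self-homeomorphisms of `𝒞` (recorded as continuous maps; continuity of the inverse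
`α g⁻¹` is automatic from the homomorphism equations). -/
def IsAction (G : Type) [Group G] (α : G → C(Cantor, Cantor)) : Prop :=
  α 1 = ContinuousMap.id Cantor ∧ ∀ g h : G, α (g * h) = (α g).comp (α h)

/-- The space `Act_G(𝒞)` of continuous actions of `G` on the Cantor space,
topologized as a subspace of `C(𝒞,𝒞)^G` (compact-open topology on each factor). -/
abbrev ActSpace (G : Type) [Group G] : Type :=
  {α : G → C(Cantor, Cantor) // IsAction G α}

/-- The conjugacy class of an action `α` under the conjugation action of `Homeo(𝒞)`. -/
def conjClass {G : Type} [Group G] (α : ActSpace G) : Set (ActSpace G) :=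
  {β | ∃ φ : Cantor ≃ₜ Cantor, ∀ g : G,
    (β.1 g : Cantor → Cantor) = φ ∘ (α.1 g : Cantor → Cantor) ∘ φ.symm}

/-- The strong topological Rokhlin property: some action on the Cantor space has a
comeager conjugacy class. -/
def HasSTRP (G : Type) [Group G] : Prop :=
  ∃ α : ActSpace G, conjClass α ∈ residual (ActSpace G)

/-- The shift action of `G` on `A^G`: `(g • x)(h) = x(g⁻¹h)`. -/
def shift {G : Type} [Group G] {A : Type} (g : G) (x : G → A) : G → A :=
  fun h => x (g⁻¹ * h)

/-- A subshift: closed (in the product of discrete topologies) and shift-invariant. -/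
def IsSubshift (G : Type) [Group G] (A : Type) (X : Set (G → A)) : Prop :=
  (letI : TopologicalSpace A := ⊥; IsClosed X) ∧ ∀ g : G, ∀ x ∈ X, shift g x ∈ X

/-- The set `X_F` of `F`-patterns of `X`. -/
def patterns {G A : Type} (F : Finset G) (X : Set (G → A)) : Set (F → A) :=
  (fun (x : G → A) (f : F) => x (f : G)) '' X

/-- Subshift of finite type, with defining window `E` and allowed patterns `𝔽`. -/
def IsSFT (G : Type) [Group G] (A : Type) (X : Set (G → A)) : Prop :=
  ∃ (E : Finset G) (𝔽 : Set (E → A)),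
    ∀ x : G → A, x ∈ X ↔ ∀ g : G, (fun e : E => shift g x (e : G)) ∈ 𝔽

/-- Continuity on a set, for a map between full shift spaces over discrete alphabets. -/
def ContinuousOnD {G A B : Type} (ψ : (G → B) → (G → A)) (Z : Set (G → B)) : Prop :=
  letI : TopologicalSpace A := ⊥
  letI : TopologicalSpace B := ⊥
  ContinuousOn ψ Z

/-- `G`-equivariance of a map between shift spaces, on a set. -/
def EquivariantOn {G A B : Type} [Group G] (ψ : (G → B) → (G → A)) (Z : Set (G → B)) : Prop :=
  ∀ g : G, ∀ z ∈ Z, ψ (shift g z) = shift g (ψ z)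

/-- A sofic subshift: a continuous `G`-equivariant image of a subshift of finite type. -/
def IsSofic (G : Type) [Group G] (A : Type) (X : Set (G → A)) : Prop :=
  ∃ (B : Type) (_ : Fintype B) (_ : Nontrivial B) (Z : Set (G → B))
    (ψ : (G → B) → (G → A)),
    IsSubshift G B Z ∧ IsSFT G B Z ∧ ContinuousOnD ψ Z ∧ EquivariantOn ψ Z ∧ ψ '' Z = X

/-- The sliding block code `Φ(y)(g) = f(d ↦ y(g·d))` induced by `f : (D → B) → A`. -/
def slidingBlock {G : Type} [Group G] {A B : Type} (D : Finset G)
    (f : (D → B) → A) : (G → B) → (G → A) :=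
  fun y g => f (fun d => y (g * (d : G)))

/-- A projectively isolated subshift. -/
def ProjIsolated (G : Type) [Group G] (A : Type) (X : Set (G → A)) : Prop :=
  ∃ (B : Type) (_ : Fintype B) (_ : Nontrivial B) (Y : Set (G → B))
    (F D : Finset G) (f : (D → B) → A),
    IsSubshift G B Y ∧
    slidingBlock D f '' Y = X ∧
    ∀ Z : Set (G → B), IsSubshift G B Z → patterns F Z = patterns F Y →
      slidingBlock D f '' Z = X

/-- An isolated subshift: an SFT `X` such that for some finite `F ⊆ G` no proper
subshift has the same `F`-patterns as `X`. -/
def IsIsolated (G : Type) [Group G] (A : Type) (X : Set (G → A)) : Prop :=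
  IsSFT G A X ∧ ∃ F : Finset G, ∀ Y : Set (G → A),
    IsSubshift G A Y → Y ⊂ X → patterns F Y ≠ patterns F X

/-- A strongly projectively isolated subshift: a continuous `G`-equivariant image of an
isolated subshift. -/
def StronglyProjIsolated (G : Type) [Group G] (A : Type) (X : Set (G → A)) : Prop :=
  ∃ (B : Type) (_ : Fintype B) (_ : Nontrivial B) (Y : Set (G → B))
    (ψ : (G → B) → (G → A)),
    IsSubshift G B Y ∧ IsIsolated G B Y ∧
    ContinuousOnD ψ Y ∧ EquivariantOn ψ Y ∧ ψ '' Y = X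

/-- Shadowing (the pseudo-orbit tracing property) of an action `act` of `G`,
with respect to a distance function `d`. -/
def HasShadowing {G X : Type} [Group G] (d : X → X → ℝ) (act : G → X → X) : Prop :=
  ∀ ε : ℝ, 0 < ε → ∃ (δ : ℝ) (S : Finset G), 0 < δ ∧
    ∀ x : G → X, (∀ g : G, ∀ s ∈ S, d (act s (x g)) (x (s * g)) < δ) →
      ∃ y : X, ∀ g : G, d (x g) (act g y) < ε

/-- A finite partition of the whole space into nonempty clopen sets. -/
def IsClopenPartition {X : Type} [TopologicalSpace X] (parts : Finset (Set X)) : Prop :=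
  (∀ P ∈ parts, IsClopen P ∧ P.Nonempty) ∧
  (∀ P ∈ parts, ∀ Q ∈ parts, P ≠ Q → Disjoint P Q) ∧
  (⋃ P ∈ parts, P) = Set.univ

/-- A finite partition of a subshift `X` into nonempty subsets that are clopen in `X`. -/
def IsClopenPartitionIn {G A : Type} (X : Set (G → A)) (parts : Finset (Set (G → A))) : Prop :=
  (letI : TopologicalSpace A := ⊥;
    ∀ P ∈ parts, P.Nonempty ∧ P ⊆ X ∧ IsClopen (Subtype.val ⁻¹' P : Set X)) ∧
  (∀ P ∈ parts, ∀ Q ∈ parts, P ≠ Q → Disjoint P Q) ∧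
  (⋃ P ∈ parts, P) = X

/-- `X` is `fam`-minimal: no nonempty proper subshift of `X` meets every member of `fam`. -/
def AMinimal {G A : Type} [Group G] (X : Set (G → A)) (fam : Set (Set (G → A))) : Prop :=
  ¬ ∃ Y : Set (G → A), IsSubshift G A Y ∧ Y.Nonempty ∧ Y ⊂ X ∧
    ∀ S ∈ fam, (Y ∩ S).Nonempty

/-- The free product of a subshift `V ⊆ B^G` and a subshift `W ⊆ B^H`, a subshift
of `B^(G∗H)`. -/
def freeProd {G H B : Type} [Group G] [Group H]
    (V : Set (G → B)) (W : Set (H → B)) : Set (Monoid.Coprod G H → B) :=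
  {x | ∀ g : Monoid.Coprod G H,
    (fun h : G => x (g * Monoid.Coprod.inl h)) ∈ V ∧
    (fun k : H => x (g * Monoid.Coprod.inr k)) ∈ W}

/-- Continuity of a map into a finite (discrete) alphabet. -/
def ContinuousToDiscrete {X A : Type} [TopologicalSpace X] (c : X → A) : Prop :=
  letI : TopologicalSpace A := ⊥
  Continuous c

/-- Continuity of a map into the shift space `A^G` over a discrete alphabet `A`. -/
def ContinuousIntoShift {X G A : Type} [TopologicalSpace X] (φ : X → (G → A)) : Prop :=
  letI : TopologicalSpace A := ⊥
  Continuous φ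

section Brouwer

open Set

variable {X : Type*}

/-- In a zero-dimensional Hausdorff space without isolated points, every nonempty clopen set `U`
splits into two nonempty clopen pieces, neither of which is cut by a prescribed clopen set `B`. -/
theorem exists_isClopen_splitting [TopologicalSpace X] [CompactSpace X] [T2Space X]
    [TotallyDisconnectedSpace X] (hX : ∀ x : X, ∀ U ∈ 𝓝 x, ∃ y ∈ U, y ≠ x) {U B : Set X}
    (hU : IsClopen U) (hne : U.Nonempty) (hB : IsClopen B) :
    ∃ V : Set X, IsClopen V ∧ (U ∩ V).Nonempty ∧ (U \ V).Nonempty ∧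
      (U ∩ V ⊆ B ∨ U ∩ V ⊆ Bᶜ) ∧ (U \ V ⊆ B ∨ U \ V ⊆ Bᶜ) := by
  by_cases h : (U ∩ B).Nonempty ∧ (U \ B).Nonempty
  · exact ⟨B, hB, h.1, h.2, .inl inter_subset_right, .inr fun x hx => hx.2⟩
  · have hUB : U ⊆ B ∨ U ⊆ Bᶜ := by
      rw [not_and_or, not_nonempty_iff_eq_empty, not_nonempty_iff_eq_empty] at h
      exact h.symm.imp sdiff_eq_empty.mp
        fun h => (disjoint_iff_inter_eq_empty.mpr h).subset_compl_right
    obtain ⟨x, hx⟩ := hne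
    obtain ⟨y, hyU, hyx⟩ := hX x U (hU.isOpen.mem_nhds hx)
    obtain ⟨V, hV, hyV, hVx⟩ := compact_exists_isClopen_in_isOpen
      (isOpen_compl_singleton (x := x)) (by simpa using hyx : y ∈ ({x}ᶜ : Set X))
    exact ⟨V, hV, ⟨y, hyU, hyV⟩, ⟨x, hx, fun h => hVx h rfl⟩,
      hUB.imp inter_subset_left.trans inter_subset_left.trans,
      hUB.imp sdiff_subset.trans sdiff_subset.trans⟩

/-- The nested sets obtained from the fibres of `r` by repeatedly cutting with the sets that
`V` selects, keeping at stage `n` the piece named by the `n`-th bit. -/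
def cutScheme {ι : Type*} (r : X → ι) (V : ℕ → Set X → Set X) (p : ι × Cantor) : ℕ → Set X
  | 0 => r ⁻¹' {p.1}
  | n + 1 => if p.2 n then cutScheme r V p n ∩ V n (cutScheme r V p n)
      else cutScheme r V p n \ V n (cutScheme r V p n)

theorem eventually_cutScheme_eq {ι : Type*} [TopologicalSpace ι] [DiscreteTopology ι]
    (r : X → ι) (V : ℕ → Set X → Set X) (p : ι × Cantor) (n : ℕ) :
    ∀ᶠ q in 𝓝 p, cutScheme r V q n = cutScheme r V p n := by
  induction n with
  | zero =>
    have h : ∀ᶠ q : ι × Cantor in 𝓝 p, q.1 = p.1 :=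
      continuous_fst.continuousAt.eventually (eventually_nhds_iff.mpr
        ⟨{p.1}, fun _ h => h, isOpen_discrete _, rfl⟩)
    filter_upwards [h] with q hq
    simp [cutScheme, hq]
  | succ n ih =>
    have hc : Continuous fun q : ι × Cantor => q.2 n := by fun_prop
    have h : ∀ᶠ q : ι × Cantor in 𝓝 p, q.2 n = p.2 n :=
      hc.continuousAt.eventually (eventually_nhds_iff.mpr
        ⟨{p.2 n}, fun _ h => h, isOpen_discrete _, rfl⟩)
    filter_upwards [ih, h] with q hq hb
    simp [cutScheme, hq, hb]

theorem exists_forall_mem_cutScheme {ι : Type*} (r : X → ι) (V : ℕ → Set X → Set X) (x : X) :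
    ∃ p : ι × Cantor, ∀ n, x ∈ cutScheme r V p n := by
  classical
  let E : ℕ → Set X := fun n =>
    n.rec (r ⁻¹' {r x}) fun n E => if x ∈ V n E then E ∩ V n E else E \ V n E
  have hE : ∀ n, E (n + 1) = if x ∈ V n (E n) then E n ∩ V n (E n) else E n \ V n (E n) :=
    fun _ => rfl
  have key : ∀ n, cutScheme r V (r x, fun n => decide (x ∈ V n (E n))) n = E n := by
    intro n
    induction n with
    | zero => rfl
    | succ n ih => simp [cutScheme, ih, hE]
  refine ⟨(r x, fun n => decide (x ∈ V n (E n))), fun n => ?_⟩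
  rw [key]
  induction n with
  | zero => exact rfl
  | succ n ih =>
    rw [hE]
    split_ifs with h
    exacts [⟨ih, h⟩, ⟨ih, h⟩]

/-- Brouwer's characterization of the Cantor space, relative to a continuous map onto a
finite discrete space. -/
theorem exists_homeomorph_prod_cantor [TopologicalSpace X] [CompactSpace X] [T2Space X]
    [TotallyDisconnectedSpace X] [SecondCountableTopology X] (hX : ∀ x : X, ∀ U ∈ 𝓝 x, ∃ y ∈ U, y ≠ x)
    {ι : Type*} [TopologicalSpace ι] [DiscreteTopology ι] [Finite ι] {r : X → ι}
    (hr : Continuous r) (hsurj : Function.Surjective r) :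
    ∃ h : ι × Cantor ≃ₜ X, ∀ p, r (h p) = p.1 := by
  have : Countable (TopologicalSpace.Clopens X) :=
    TopologicalSpace.Clopens.countable_iff_secondCountable.mpr inferInstance
  obtain ⟨B, hB⟩ := exists_surjective_nat (TopologicalSpace.Clopens X)
  have hsplit : ∀ (n : ℕ) (U : Set X), ∃ V : Set X, IsClopen U → U.Nonempty →
      IsClopen V ∧ (U ∩ V).Nonempty ∧ (U \ V).Nonempty ∧
      (U ∩ V ⊆ B n ∨ U ∩ V ⊆ (B n : Set X)ᶜ) ∧ (U \ V ⊆ B n ∨ U \ V ⊆ (B n : Set X)ᶜ) := by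
    intro n U
    by_cases h : IsClopen U ∧ U.Nonempty
    · obtain ⟨V, hV⟩ := exists_isClopen_splitting hX h.1 h.2 (B n).isClopen
      exact ⟨V, fun _ _ => hV⟩
    · exact ⟨∅, fun h₁ h₂ => (h ⟨h₁, h₂⟩).elim⟩
  choose V hV using hsplit
  set D := cutScheme r V with hD
  have hDclopen : ∀ p n, IsClopen (D p n) ∧ (D p n).Nonempty := by
    intro p n
    induction n with
    | zero =>
      obtain ⟨x, hx⟩ := hsurj p.1
      exact ⟨(isClopen_discrete {p.1}).preimage hr, x, hx⟩
    | succ n ih =>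
      obtain ⟨h₁, h₂, h₃, -⟩ := hV n _ ih.1 ih.2
      cases hb : p.2 n
      · simpa [hD, cutScheme, hb] using And.intro (ih.1.diff h₁) h₃
      · simpa [hD, cutScheme, hb] using And.intro (ih.1.inter h₁) h₂
  have hDsucc : ∀ p n, D p (n + 1) ⊆ D p n := by
    intro p n
    cases hb : p.2 n <;> simp [hD, cutScheme, hb]
  have hDB : ∀ p n, D p (n + 1) ⊆ B n ∨ D p (n + 1) ⊆ (B n : Set X)ᶜ := by
    intro p n
    obtain ⟨-, -, -, h₁, h₂⟩ := hV n _ (hDclopen p n).1 (hDclopen p n).2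
    cases hb : p.2 n
    · simpa [hD, cutScheme, hb] using h₂
    · simpa [hD, cutScheme, hb] using h₁
  have hex : ∀ p, ∃ x, ∀ n, x ∈ D p n := fun p =>
    (IsCompact.nonempty_iInter_of_sequence_nonempty_isCompact_isClosed (D p) (hDsucc p)
      (fun n => (hDclopen p n).2) (hDclopen p 0).1.isClosed.isCompact
      fun n => (hDclopen p n).1.isClosed).imp fun x hx => mem_iInter.mp hx
  choose g hg using hex
  have hrg : ∀ p, r (g p) = p.1 := fun p => hg p 0
  have hmem : ∀ p n, g p ∈ B n ↔ D p (n + 1) ⊆ B n := fun p n =>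
    ⟨fun h => (hDB p n).resolve_right fun h' => h' (hg p _) h, fun h => h (hg p _)⟩
  have hcont : Continuous g := by
    refine isTopologicalBasis_isClopen.continuous_iff.mpr fun s hs => ?_
    obtain ⟨n, hn⟩ := hB ⟨s, hs⟩
    obtain rfl : (B n : Set X) = s := by rw [hn]; rfl
    refine isOpen_iff_mem_nhds.mpr fun p hp => ?_
    filter_upwards [eventually_cutScheme_eq r V p (n + 1)] with q hq
    exact (hmem q n).mpr (hq.trans_subset ((hmem p n).mp hp))
  have hinj : Function.Injective g := by
    intro p q hpq
    have h1 : p.1 = q.1 := by rw [← hrg, ← hrg, hpq]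
    have key : ∀ n, D p n = D q n ∧ ∀ m < n, p.2 m = q.2 m := by
      intro n
      induction n with
      | zero => simp [hD, cutScheme, h1]
      | succ n ih =>
        have hb : p.2 n = q.2 n := by
          have hp := hg p (n + 1)
          have hq := hg q (n + 1)
          rw [← hpq] at hq
          simp only [hD, cutScheme] at hp hq
          rw [← hD, ← ih.1] at hq
          cases hb : p.2 n <;> cases hb' : q.2 n <;> simp_all
        refine ⟨by simp only [hD, cutScheme] at ih ⊢; rw [ih.1, hb], fun m hm => ?_⟩
        rcases Nat.lt_succ_iff_lt_or_eq.mp hm with hm | rfl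
        exacts [ih.2 m hm, hb]
    exact Prod.ext h1 (funext fun n => (key (n + 1)).2 n n.lt_succ_self)
  have hsurjg : Function.Surjective g := by
    intro x
    obtain ⟨p, hp⟩ := exists_forall_mem_cutScheme r V x
    have hdense : x ∈ closure (range g) := by
      refine isTopologicalBasis_isClopen.mem_closure_iff.mpr fun s hs hx => ?_
      obtain ⟨n, hn⟩ := hB ⟨s, hs⟩
      obtain rfl : (B n : Set X) = s := by rw [hn]; rfl
      exact ⟨g p, (hmem p n).mpr ((hDB p n).resolve_right fun h => h (hp _) hx), p, rfl⟩
    rwa [(isCompact_range hcont).isClosed.closure_eq] at hdense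
  exact ⟨(isHomeomorph_iff_continuous_bijective.mpr ⟨hcont, hinj, hsurjg⟩).homeomorph, hrg⟩

end Brouwer

section Restriction

open Set Filter

/-- The first `n` bits of a point of the Cantor space. -/
def res (n : ℕ) (x : Cantor) : Fin n → Bool := fun i => x i

theorem continuous_res (n : ℕ) : Continuous (res n) := by
  unfold res
  fun_prop

theorem res_eq_of_le {k n : ℕ} (h : k ≤ n) {x y : Cantor} (hxy : res n x = res n y) :
    res k x = res k y :=
  funext fun i => congrFun hxy (Fin.castLE h i)

theorem res_surjective (n : ℕ) : Function.Surjective (res n) := fun z =>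
  ⟨fun i => if h : i < n then z ⟨i, h⟩ else false, funext fun i => by simp [res]⟩

theorem exists_res_eq_imp_mem {V : Set (Cantor × Cantor)} (hV : ∀ x, V ∈ 𝓝 (x, x)) :
    ∃ n, ∀ x y, res n x = res n y → (x, y) ∈ V := by
  have hanti : Antitone fun n => {p : Cantor × Cantor | res n p.1 = res n p.2} :=
    fun k n h p hp => res_eq_of_le h hp
  obtain ⟨n, hn⟩ := exists_subset_nhds_of_compactSpace hanti.directed_ge
    (fun n => isClosed_eq ((continuous_res n).comp continuous_fst)
      ((continuous_res n).comp continuous_snd)) (U := V) (by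
      rintro ⟨x, y⟩ hxy
      obtain rfl : x = y := funext fun i =>
        congrFun (mem_iInter.mp hxy (i + 1)) ⟨i, i.lt_succ_self⟩
      exact hV x)
  exact ⟨n, fun x y h => hn h⟩

theorem setOf_res_eq_mem_nhds (n : ℕ) (x : Cantor) :
    {p : Cantor × Cantor | res n p.1 = res n p.2} ∈ 𝓝 (x, x) := by
  have h : IsOpen {p : Cantor × Cantor | res n p.1 = res n p.2} :=
    (isOpen_discrete {q : (Fin n → Bool) × (Fin n → Bool) | q.1 = q.2}).preimage
      (((continuous_res n).comp continuous_fst).prodMk ((continuous_res n).comp continuous_snd))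
  exact h.mem_nhds rfl

theorem exists_ne_mem_of_mem_nhds (x : Cantor) {U : Set Cantor} (hU : U ∈ 𝓝 x) :
    ∃ y ∈ U, y ≠ x := by
  have hlim : Tendsto (fun n : ℕ => Function.update x n (!x n)) atTop (𝓝 x) := by
    refine tendsto_pi_nhds.mpr fun i => tendsto_const_nhds.congr' ?_
    filter_upwards [eventually_gt_atTop i] with n hn
    simp [Function.update_of_ne hn.ne]
  obtain ⟨n, hn⟩ := (hlim.eventually_mem hU).exists
  exact ⟨_, hn, fun h => by simpa using congrFun h n⟩

theorem exists_forall_res_eq_imp_mem {f : C(Cantor, Cantor)} {N : Set C(Cantor, Cantor)}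
    (hN : N ∈ 𝓝 f) : ∃ k, ∀ f' : C(Cantor, Cantor), (∀ x, res k (f x) = res k (f' x)) → f' ∈ N := by
  obtain ⟨V, hV, hVN⟩ := (nhds_basis_uniformity'
    ContinuousMap.hasBasis_compactConvergenceUniformity_of_compact).mem_iff.mp hN
  obtain ⟨k, hk⟩ := exists_res_eq_imp_mem fun x =>
    mem_nhdsSet_iff_forall.mp (nhdsSet_diagonal_le_uniformity hV) (x, x) rfl
  exact ⟨k, fun f' h => hVN fun x => hk _ _ (h x)⟩

theorem exists_dist_lt_imp_mem {X : Type*} [t : TopologicalSpace X] [CompactSpace X]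
    (m : MetricSpace X) (h : m.toUniformSpace.toTopologicalSpace = t) {V : Set (X × X)}
    (hV : ∀ x, V ∈ 𝓝 (x, x)) : ∃ δ > 0, ∀ x y, m.dist x y < δ → (x, y) ∈ V := by
  subst h
  have hV' : V ∈ uniformity X := by
    rw [← nhdsSet_diagonal_eq_uniformity, mem_nhdsSet_iff_forall]
    rintro ⟨x, y⟩ (hxy : x = y)
    exact hxy ▸ hV x
  obtain ⟨δ, hδ, h⟩ := Metric.mem_uniformity_dist.mp hV'
  exact ⟨δ, hδ, fun x y hxy => h hxy⟩

theorem setOf_dist_lt_mem_nhds {X : Type*} [t : TopologicalSpace X]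
    (m : MetricSpace X) (h : m.toUniformSpace.toTopologicalSpace = t) {ε : ℝ} (hε : 0 < ε)
    (x : X) : {p : X × X | m.dist p.1 p.2 < ε} ∈ 𝓝 (x, x) := by
  subst h
  exact (isOpen_lt continuous_dist continuous_const).mem_nhds (by simpa using hε)

end Restriction

section Actions

open Set Filter

variable {G : Type} [Group G]

theorem exists_finset_forall_res_eq_imp_mem {β : ActSpace G} {N : Set (ActSpace G)}
    (hN : N ∈ 𝓝 β) : ∃ (F : Finset G) (k : ℕ), ∀ β' : ActSpace G,
      (∀ f ∈ F, ∀ x, res k (β.1 f x) = res k (β'.1 f x)) → β' ∈ N := by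
  obtain ⟨u, hu, huN⟩ := (mem_nhds_subtype _ _ _).mp hN
  rw [nhds_pi, Filter.mem_pi'] at hu
  obtain ⟨F, t, ht, htu⟩ := hu
  choose k hk using fun g => exists_forall_res_eq_imp_mem (ht g)
  refine ⟨F, F.sup k, fun β' h => huN (htu fun f hf => hk f _ fun x => ?_)⟩
  exact res_eq_of_le (Finset.le_sup (f := k) hf) (h f hf x)

/-- The symbolic names, with respect to a colouring `c`, of the orbits of `β`. -/
def itineraries {A : Type*} (β : ActSpace G) (c : Cantor → A) : Set (G → A) :=
  range fun x g => c (β.1 g x)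

theorem isClosed_itineraries {A : Type*} [TopologicalSpace A] [T2Space A] (β : ActSpace G)
    {c : Cantor → A} (hc : Continuous c) : IsClosed (itineraries β c) :=
  (isCompact_range (continuous_pi fun g => hc.comp (β.1 g).continuous)).isClosed

theorem countable_itineraries_conjClass (α : ActSpace G) (n : ℕ) :
    ((fun β => itineraries β (res n)) '' conjClass α).Countable := by
  classical
  have : Countable (TopologicalSpace.Clopens Cantor) :=
    TopologicalSpace.Clopens.countable_iff_secondCountable.mpr inferInstance
  refine (countable_range fun (k : Fin n → TopologicalSpace.Clopens Cantor) =>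
    itineraries α fun x i => decide (x ∈ k i)).mono ?_
  rintro _ ⟨β, ⟨φ, hφ⟩, rfl⟩
  have hclopen : ∀ i : Fin n, IsClopen {x : Cantor | φ x i = true} := fun i =>
    (isClopen_discrete {true}).preimage ((continuous_apply (i : ℕ)).comp φ.continuous)
  refine ⟨fun i => ⟨_, hclopen i⟩, ?_⟩
  have hdec : ∀ (x : Cantor) (i : Fin n),
      decide (x ∈ (⟨_, hclopen i⟩ : TopologicalSpace.Clopens Cantor)) = φ x i := fun x i =>
    Bool.eq_iff_iff.mpr decide_eq_true_iff
  simp only [itineraries, hdec, hφ]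
  refine (φ.symm.surjective.range_comp fun x (g : G) (i : Fin n) => φ (α.1 g x) i).symm

theorem eventually_mem_interior_closure_itineraries_eq {α : ActSpace G}
    (hα : conjClass α ∈ residual (ActSpace G)) (n : ℕ) :
    ∀ᶠ β in residual (ActSpace G),
      β ∈ interior (closure {β' | itineraries β' (res n) = itineraries β (res n)}) := by
  have hc := countable_itineraries_conjClass α n
  have hmem : ∀ᶠ β in residual (ActSpace G),
      ∀ X ∈ (fun β => itineraries β (res n)) '' conjClass α,
        β ∉ frontier (closure {β' | itineraries β' (res n) = X}) :=
    (eventually_countable_ball hc).mpr fun X _ =>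
      residual_of_dense_open isClosed_frontier.isOpen_compl
        (interior_eq_empty_iff_dense_compl.mp (interior_frontier isClosed_closure))
  filter_upwards [hα, hmem] with β hβ h
  by_contra hint
  refine h _ ⟨β, hβ, rfl⟩ ?_
  rw [isClosed_closure.frontier_eq]
  exact ⟨subset_closure rfl, hint⟩

/-- If `ξ` is a pseudo-orbit of `β` at resolution `l`, then some action that agrees with `β` at
resolution `l` up to pseudo-orbits has a genuine orbit with the same itinerary as `ξ`. -/
theorem exists_action_realizing_pseudoOrbit [Countable G] (β : ActSpace G) (l : ℕ) (F : Finset G)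
    (ξ : G → Cantor)
    (hξ : ∀ g, ∀ f ∈ F, ∃ x, res l x = res l (ξ g) ∧ res l (β.1 f x) = res l (ξ (f * g))) :
    ∃ γ : ActSpace G, (∃ y, ∀ g, res l (γ.1 g y) = res l (ξ g)) ∧
      ∀ f ∈ F, ∀ y, ∃ x, res l x = res l y ∧ res l (β.1 f x) = res l (γ.1 f y) := by
  let Z : Set (G → Fin l → Bool) :=
    {z | ∀ g, ∀ f ∈ F, ∃ x, res l x = z g ∧ res l (β.1 f x) = z (f * g)}
  have hZ : IsClosed Z := by
    simp only [Z, ofPred_forall]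
    refine isClosed_iInter fun g => isClosed_iInter fun f => isClosed_iInter fun _ => ?_
    have hc : Continuous fun z : G → Fin l → Bool => (z g, z (f * g)) := by fun_prop
    exact (isClosed_discrete {q : (Fin l → Bool) × (Fin l → Bool) |
      ∃ x, res l x = q.1 ∧ res l (β.1 f x) = q.2}).preimage hc
  have : CompactSpace Z := isCompact_iff_compactSpace.mp hZ.isCompact
  let σ : G → Z → Z := fun h z => ⟨fun g => z.1 (g * h), fun g f hf => by
    simpa [mul_assoc] using z.2 (g * h) f hf⟩
  have hσ : ∀ h, Continuous (σ h) := fun h =>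
    continuous_induced_rng.mpr (continuous_pi fun g =>
      (continuous_apply (g * h)).comp continuous_subtype_val)
  have hσ1 : ∀ z, σ 1 z = z := fun z => Subtype.ext (funext fun g => by simp [σ])
  have hσm : ∀ a b z, σ (a * b) z = σ a (σ b z) := fun a b z =>
    Subtype.ext (funext fun g => by simp [σ, mul_assoc])
  let r : Z × Cantor → Fin l → Bool := fun w => w.1.1 1
  have hr : Continuous r :=
    (continuous_apply 1).comp (continuous_subtype_val.comp continuous_fst)
  have hrs : Function.Surjective r := by
    intro i
    obtain ⟨x, rfl⟩ := res_surjective l i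
    refine ⟨(⟨fun g => res l (β.1 g x), fun g f _ => ⟨β.1 g x, rfl, ?_⟩⟩, x), ?_⟩
    · exact congrArg (res l) (DFunLike.congr_fun (β.2.2 f g) x).symm
    · simp only [r]; rw [β.2.1]; rfl
  have hperf : ∀ w : Z × Cantor, ∀ U ∈ 𝓝 w, ∃ w' ∈ U, w' ≠ w := by
    rintro ⟨z, x⟩ U hU
    have hx : Prod.mk z ⁻¹' U ∈ 𝓝 x := (Continuous.prodMk_right z).continuousAt.preimage_mem_nhds hU
    obtain ⟨y, hy, hyx⟩ := exists_ne_mem_of_mem_nhds x hx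
    exact ⟨(z, y), hy, fun h => hyx (Prod.ext_iff.mp h).2⟩
  obtain ⟨h₁, hh₁⟩ := exists_homeomorph_prod_cantor hperf hr hrs
  obtain ⟨h₂, hh₂⟩ := exists_homeomorph_prod_cantor
    (fun x _ => exists_ne_mem_of_mem_nhds x) (continuous_res l) (res_surjective l)
  let h := h₁.symm.trans h₂
  have hh : ∀ w, res l (h w) = w.1.1 1 := fun w => by
    have := hh₁ (h₁.symm w)
    rw [h₁.apply_symm_apply] at this
    exact (hh₂ _).trans this.symm
  let γ : G → C(Cantor, Cantor) := fun g =>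
    ⟨fun y => h (σ g (h.symm y).1, (h.symm y).2), by
      have := hσ g
      fun_prop⟩
  have hγ : ∀ g w, γ g (h w) = h (σ g w.1, w.2) := fun g w => by simp [γ]
  have hact : IsAction G γ := by
    refine ⟨ContinuousMap.ext fun y => ?_, fun a b => ContinuousMap.ext fun y => ?_⟩ <;>
    obtain ⟨w, rfl⟩ := h.surjective y
    · rw [hγ, hσ1]; rfl
    · rw [ContinuousMap.comp_apply, hγ, hγ, hγ, hσm]
  refine ⟨⟨γ, hact⟩, ⟨h (⟨fun g => res l (ξ g), hξ⟩, ξ 1), fun g => ?_⟩, fun f hf y => ?_⟩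
  · change res l (γ g _) = _
    rw [hγ, hh]
    simp [σ]
  · obtain ⟨w, rfl⟩ := h.surjective y
    change ∃ x, res l x = _ ∧ _ = res l (γ f _)
    rw [hγ, hh, hh]
    simpa [σ] using w.1.2 1 f hf

theorem hasShadowing_of_mem_interior_closure [Countable G]
    (m : MetricSpace Cantor)
    (hcompat : m.toUniformSpace.toTopologicalSpace = (inferInstance : TopologicalSpace Cantor))
    {β : ActSpace G} (hβ : ∀ n,
      β ∈ interior (closure {β' | itineraries β' (res n) = itineraries β (res n)})) :
    HasShadowing (fun x y => m.dist x y) (fun g z => (β.1 g) z) := by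
  intro ε hε
  obtain ⟨n, hn⟩ := exists_res_eq_imp_mem (setOf_dist_lt_mem_nhds m hcompat hε)
  obtain ⟨F, k, hFk⟩ := exists_finset_forall_res_eq_imp_mem (mem_interior_iff_mem_nhds.mp (hβ n))
  obtain ⟨l, hl⟩ := exists_res_eq_imp_mem (V := ⋂ f ∈ F,
      (fun p : Cantor × Cantor => (β.1 f p.1, β.1 f p.2)) ⁻¹' {p | res k p.1 = res k p.2})
    fun x => (Filter.biInter_finset_mem F).mpr fun f _ => by
      have hc : Continuous fun p : Cantor × Cantor => (β.1 f p.1, β.1 f p.2) := by fun_prop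
      exact hc.continuousAt.preimage_mem_nhds (setOf_res_eq_mem_nhds k _)
  set L := max l (max k n)
  obtain ⟨δ, hδ, hδL⟩ := exists_dist_lt_imp_mem m hcompat (setOf_res_eq_mem_nhds L)
  refine ⟨δ, F, hδ, fun ξ hξ => ?_⟩
  obtain ⟨γ, ⟨y, hy⟩, hγ⟩ := exists_action_realizing_pseudoOrbit β L F ξ
    fun g f hf => ⟨ξ g, rfl, hδL _ _ (hξ g f hf)⟩
  have hγmem : γ ∈ closure {β' | itineraries β' (res n) = itineraries β (res n)} := by
    refine hFk γ fun f hf y => ?_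
    obtain ⟨x, hxy, hx⟩ := hγ f hf y
    have hxy' := mem_iInter₂.mp (hl x y (res_eq_of_le (le_max_left _ _) hxy)) f hf
    exact (Eq.symm hxy').trans (res_eq_of_le (le_max_of_le_right (le_max_left _ _)) hx)
  have hclosed : IsClosed {β' : ActSpace G |
      (fun g => res n (β'.1 g y)) ∈ itineraries β (res n)} :=
    (isClosed_itineraries β (continuous_res n)).preimage (continuous_pi fun g =>
      (continuous_res n).comp ((continuous_eval_const y).comp
        ((continuous_apply g).comp continuous_subtype_val)))
  obtain ⟨x, hx⟩ := closure_minimal (fun β' hβ' => by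
    rw [mem_ofPred_eq] at hβ' ⊢
    exact hβ' ▸ mem_range_self y) hclosed hγmem
  refine ⟨x, fun g => hn _ _ ?_⟩
  rw [← res_eq_of_le (le_max_of_le_right (le_max_right _ _)) (hy g)]
  exact (congrFun hx g).symm

end Actions

/-- For a finitely generated group with the strong topological Rokhlin
property, shadowing (w.r.t. any compatible metric on the Cantor space) is generic in
`Act_G(𝒞)`. -/
theorem shadowing_generic_of_strp (G : Type) [Group G] [Countable G]
    (hfg : Group.FG G) (hstrp : HasSTRP G)
    (m : MetricSpace Cantor)
    (hcompat : m.toUniformSpace.toTopologicalSpace =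
      (inferInstance : TopologicalSpace Cantor)) :
    {α : ActSpace G | HasShadowing (fun x y => m.dist x y)
        (fun g z => (α.1 g) z)} ∈ residual (ActSpace G) := by
  obtain ⟨α, hα⟩ := hstrp
  filter_upwards [eventually_countable_forall.mpr
    (eventually_mem_interior_closure_itineraries_eq hα)] with β hβ
  exact hasShadowing_of_mem_interior_closure m hcompat hβ
end

section
/- Let G be a countable group that does not have the strong topological Rokhlin property, and fix a compatible metric on the Cantor space 𝒞. Then the set {α ∈ Act_G(𝒞) : the action α has shadowing} is dense in Act_G(𝒞) but meager in Act_G(𝒞); in particular, shadowing is not generic for actions of G. -/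
open Topology

section

open Set Filter

/-! ### Colorings: continuous maps to `ℕ` -/

/-- The coloring recording two colorings at once. -/
def pairColoring {X : Type} [TopologicalSpace X] (c d : C(X, ℕ)) : C(X, ℕ) :=
  ⟨fun x => Nat.pair (c x) (d x),
    (continuous_of_discreteTopology (f := fun p : ℕ × ℕ => Nat.pair p.1 p.2)).comp
      (c.continuous.prodMk d.continuous)⟩

theorem pairColoring_apply {X : Type} [TopologicalSpace X] (c d : C(X, ℕ)) (x : X) :
    pairColoring c d x = Nat.pair (c x) (d x) := rfl

theorem pairColoring_eq_iff {X : Type} [TopologicalSpace X] (c d : C(X, ℕ)) (x y : X) :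
    pairColoring c d x = pairColoring c d y ↔ c x = c y ∧ d x = d y :=
  Nat.pair_eq_pair

/-- The first component of a coloring, inverse to pairing. -/
def fstColoring {X : Type} [TopologicalSpace X] (c : C(X, ℕ)) : C(X, ℕ) :=
  ⟨fun x => (c x).unpair.1,
    (continuous_of_discreteTopology (f := fun n : ℕ => n.unpair.1)).comp c.continuous⟩

/-- The second component of a coloring, inverse to pairing. -/
def sndColoring {X : Type} [TopologicalSpace X] (c : C(X, ℕ)) : C(X, ℕ) :=
  ⟨fun x => (c x).unpair.2,
    (continuous_of_discreteTopology (f := fun n : ℕ => n.unpair.2)).comp c.continuous⟩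

theorem pairColoring_fst_snd {X : Type} [TopologicalSpace X] (c : C(X, ℕ)) :
    pairColoring (fstColoring c) (sndColoring c) = c := by
  ext x
  exact Nat.pair_unpair _

theorem fstColoring_pairColoring {X : Type} [TopologicalSpace X] (c d : C(X, ℕ)) :
    fstColoring (pairColoring c d) = c := by
  ext x
  simp [fstColoring, pairColoring]

theorem exists_coloring_forall_finset {X ι : Type} [TopologicalSpace X] (u : ι → C(X, ℕ))
    (t : Finset ι) : ∃ c : C(X, ℕ), ∀ x y, c x = c y ↔ ∀ i ∈ t, u i x = u i y := by
  classical
  induction t using Finset.induction_on with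
  | empty => exact ⟨ContinuousMap.const X 0, by simp⟩
  | insert a s _ ih =>
    obtain ⟨c, hc⟩ := ih
    exact ⟨pairColoring (u a) c, fun x y => by
      rw [pairColoring_eq_iff, hc, Finset.forall_mem_insert]⟩

theorem eventually_coloring_eq {X : Type} [TopologicalSpace X] (c : C(X, ℕ)) (x : X) :
    ∀ᶠ y in 𝓝 x, c y = c x :=
  (c.continuous.tendsto x).eventually (p := fun n => n = c x) (by simp)

/-- A family of colorings separates points. -/
def Separates {X ι : Type} [TopologicalSpace X] (u : ι → C(X, ℕ)) : Prop :=
  ∀ x y, (∀ i, u i x = u i y) → x = y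

theorem isOpen_coloring_ne {X : Type} [TopologicalSpace X] (c : C(X, ℕ)) :
    IsOpen {p : X × X | c p.1 ≠ c p.2} := by
  have : Continuous fun p : X × X => (c p.1, c p.2) := by fun_prop
  exact (isOpen_discrete {q : ℕ × ℕ | q.1 ≠ q.2}).preimage this

theorem isClosed_coloring_ne {X : Type} [TopologicalSpace X] (c : C(X, ℕ)) :
    IsClosed {p : X × X | c p.1 ≠ c p.2} := by
  have : Continuous fun p : X × X => (c p.1, c p.2) := by fun_prop
  exact (isClosed_discrete {q : ℕ × ℕ | q.1 ≠ q.2}).preimage this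

theorem Separates.exists_finset {X ι : Type} [TopologicalSpace X] [CompactSpace X]
    {u : ι → C(X, ℕ)} (hu : Separates u) {K : Set (X × X)} (hK : IsClosed K)
    (hdiag : ∀ x, (x, x) ∉ K) :
    ∃ t : Finset ι, ∀ x y, (∀ i ∈ t, u i x = u i y) → (x, y) ∉ K := by
  obtain ⟨t, ht⟩ := hK.isCompact.elim_finite_subcover
    (fun i => {p : X × X | u i p.1 ≠ u i p.2}) (fun i => isOpen_coloring_ne _) (by
      rintro ⟨x, y⟩ hxy
      by_contra h
      simp only [mem_iUnion, mem_ofPred_eq, not_exists, not_not] at h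
      obtain rfl := hu x y h
      exact hdiag x hxy)
  refine ⟨t, fun x y h hxy => ?_⟩
  have := ht hxy
  simp only [mem_iUnion, mem_ofPred_eq] at this
  obtain ⟨i, hi, hne⟩ := this
  exact hne (h i hi)

theorem Separates.exists_coloring {X ι : Type} [TopologicalSpace X] [CompactSpace X]
    {u : ι → C(X, ℕ)} (hu : Separates u) {K : Set (X × X)} (hK : IsClosed K)
    (hdiag : ∀ x, (x, x) ∉ K) :
    ∃ c : C(X, ℕ), ∀ x y, c x = c y → (x, y) ∉ K := by
  obtain ⟨t, ht⟩ := hu.exists_finset hK hdiag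
  obtain ⟨c, hc⟩ := exists_coloring_forall_finset u t
  exact ⟨c, fun x y h => ht x y ((hc x y).1 h)⟩

theorem finite_range_coloring {X : Type} [TopologicalSpace X] [CompactSpace X] (c : C(X, ℕ)) :
    (range c).Finite :=
  (isCompact_range c.continuous).finite_of_discrete

/-! ### Homeomorphisms from coherent sequences -/

theorem exists_homeomorph_of_coherent {X X' B : Type} [TopologicalSpace X] [TopologicalSpace X']
    [CompactSpace X] [CompactSpace X'] [TopologicalSpace B] [T2Space B]
    (C : ℕ → X → B) (D : ℕ → X' → B) (hC : ∀ n, Continuous (C n)) (hD : ∀ n, Continuous (D n))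
    (hrange : ∀ n, range (C n) = range (D n)) (π : B → B)
    (hπC : ∀ n x, C n x = π (C (n + 1) x)) (hπD : ∀ n x, D n x = π (D (n + 1) x))
    (hsC : ∀ x y, (∀ n, C n x = C n y) → x = y) (hsD : ∀ x y, (∀ n, D n x = D n y) → x = y) :
    ∃ h : X ≃ₜ X', ∀ n x, D n (h x) = C n x := by
  have lift : ∀ {Y Y' : Type} [TopologicalSpace Y] [TopologicalSpace Y'] [CompactSpace Y']
      (U : ℕ → Y → B) (V : ℕ → Y' → B), (∀ n, Continuous (V n)) →
      (∀ n, range (U n) = range (V n)) → (∀ n x, U n x = π (U (n + 1) x)) →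
      (∀ n x, V n x = π (V (n + 1) x)) → ∀ x, ∃ y, ∀ n, V n y = U n x := by
    intro Y Y' _ _ _ U V hV hr hU hV' x
    have hcl : ∀ n, IsClosed {y | V n y = U n x} := fun n =>
      isClosed_eq (hV n) continuous_const
    have := IsCompact.nonempty_iInter_of_sequence_nonempty_isCompact_isClosed
      (fun n => {y | V n y = U n x})
      (fun n y hy => by
        simp only [mem_ofPred_eq] at hy ⊢
        rw [hV', hU, hy])
      (fun n => by
        have : U n x ∈ range (V n) := hr n ▸ mem_range_self x
        exact this)
      (hcl 0).isCompact hcl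
    obtain ⟨y, hy⟩ := this
    exact ⟨y, fun n => mem_iInter.1 hy n⟩
  choose f hf using lift C D hD hrange hπC hπD
  choose g hg using lift D C hC (fun n => (hrange n).symm) hπD hπC
  have hemb : Topology.IsClosedEmbedding (fun x n => D n x : X' → ℕ → B) :=
    (continuous_pi hD).isClosedEmbedding fun x y h => hsD x y (congrFun h)
  have hembC : Topology.IsClosedEmbedding (fun x n => C n x : X → ℕ → B) :=
    (continuous_pi hC).isClosedEmbedding fun x y h => hsC x y (congrFun h)
  refine ⟨⟨⟨f, g, fun x => hsC _ _ fun n => ?_, fun y => hsD _ _ fun n => ?_⟩, ?_, ?_⟩,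
    fun n x => hf x n⟩
  · rw [hg, hf]
  · rw [hf, hg]
  · rw [hemb.continuous_iff]
    convert continuous_pi hC using 1
    ext x n
    exact hf x n
  · rw [hembC.continuous_iff]
    convert continuous_pi hD using 1
    ext x n
    exact hg x n

/-- The set of names of points: the itinerary of `x` under the family `α`, read by `c`. -/
def names {X Γ : Type} [TopologicalSpace X] (α : Γ → C(X, X)) (c : C(X, ℕ)) : Set (Γ → ℕ) :=
  range fun x g => c (α g x)

theorem continuous_name {X Γ : Type} [TopologicalSpace X] (α : Γ → C(X, X)) (c : C(X, ℕ)) :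
    Continuous fun (x : X) (g : Γ) => c (α g x) :=
  continuous_pi fun g => c.continuous.comp (α g).continuous

/-- Back-and-forth: two families of self-maps are conjugate as soon as equality of sets of
names can be propagated along refinements of colorings. -/
theorem exists_conjugacy_of_back_and_forth {X X' Γ : Type} [TopologicalSpace X]
    [TopologicalSpace X'] [CompactSpace X] [CompactSpace X'] {u : ℕ → C(X, ℕ)} {v : ℕ → C(X', ℕ)}
    (hu : Separates u) (hv : Separates v) (α : Γ → C(X, X)) (β : Γ → C(X', X')) (e : Γ)
    (hαe : α e = ContinuousMap.id X) (hβe : β e = ContinuousMap.id X')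
    (forth : ∀ c d, names α c = names β d → ∀ c₁, ∃ d₁,
      names α (pairColoring c c₁) = names β (pairColoring d d₁))
    (back : ∀ c d, names α c = names β d → ∀ d₁, ∃ c₁,
      names α (pairColoring c c₁) = names β (pairColoring d d₁))
    (c₀ : C(X, ℕ)) (d₀ : C(X', ℕ)) (h₀ : names α c₀ = names β d₀) :
    ∃ h : X ≃ₜ X', (∀ x, d₀ (h x) = c₀ x) ∧ ∀ g x, h (α g x) = β g (h x) := by
  choose F hF using forth
  choose B hB using back
  let St := {p : C(X, ℕ) × C(X', ℕ) // names α p.1 = names β p.2}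
  let step : ℕ → St → St := fun n p =>
    ⟨(pairColoring (pairColoring p.1.1 (u n))
        (B _ _ (hF p.1.1 p.1.2 p.2 (u n)) (v n)),
      pairColoring (pairColoring p.1.2 (F p.1.1 p.1.2 p.2 (u n))) (v n)),
      hB _ _ (hF p.1.1 p.1.2 p.2 (u n)) (v n)⟩
  let s : ℕ → St := fun n => Nat.rec ⟨(c₀, d₀), h₀⟩ step n
  have hs : ∀ n, s (n + 1) = step n (s n) := fun n => rfl
  have hu1 : ∀ n x y, (s (n + 1)).1.1 x = (s (n + 1)).1.1 y → u n x = u n y := by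
    intro n x y h
    rw [hs] at h
    simp only [step, pairColoring_eq_iff] at h
    exact h.1.2
  have hv1 : ∀ n x y, (s (n + 1)).1.2 x = (s (n + 1)).1.2 y → v n x = v n y := by
    intro n x y h
    rw [hs] at h
    simp only [step, pairColoring_eq_iff] at h
    exact h.2
  obtain ⟨h, hh⟩ := exists_homeomorph_of_coherent (B := Γ → ℕ)
    (fun n x g => (s n).1.1 (α g x)) (fun n x g => (s n).1.2 (β g x))
    (fun n => continuous_name _ _) (fun n => continuous_name _ _) (fun n => (s n).2)
    (fun w g => (w g).unpair.1.unpair.1)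
    (fun n x => by
      funext g
      rw [hs]
      simp [step, pairColoring_apply])
    (fun n x => by
      funext g
      rw [hs]
      simp [step, pairColoring_apply])
    (fun x y hxy => hu x y fun n => by
      have := congrFun (hxy (n + 1)) e
      simp only [hαe, ContinuousMap.id_apply] at this
      exact hu1 n x y this)
    (fun x y hxy => hv x y fun n => by
      have := congrFun (hxy (n + 1)) e
      simp only [hβe, ContinuousMap.id_apply] at this
      exact hv1 n x y this)
  have hh' : ∀ n x g, (s n).1.2 (β g (h x)) = (s n).1.1 (α g x) := fun n x g =>
    congrFun (hh n x) g
  have hh1 : ∀ n x, (s n).1.2 (h x) = (s n).1.1 x := fun n x => by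
    simpa [hαe, hβe] using hh' n x e
  refine ⟨h, fun x => hh1 0 x, fun g x => hv _ _ fun n => hv1 n _ _ ?_⟩
  exact (hh1 (n + 1) (α g x)).trans (hh' (n + 1) x g).symm

/-! ### Cantor-like spaces -/

/-- Compact spaces with a countable separating family of colorings and no isolated points. -/
structure CantorLike (X : Type) [TopologicalSpace X] : Prop where
  compact : CompactSpace X
  separates : ∃ u : ℕ → C(X, ℕ), Separates u
  perfect : ∀ x : X, ∃ f : ℕ → X, Tendsto f atTop (𝓝 x) ∧ ∀ n, f n ≠ x

theorem CantorLike.exists_image_fiber {X : Type} [TopologicalSpace X] (hX : CantorLike X)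
    (d : C(X, ℕ)) (x₀ : X) (V : Finset ℕ) (hV : V.Nonempty) :
    ∃ f : C(X, ℕ), f '' {x | d x = d x₀} = V := by
  classical
  induction hV using Finset.Nonempty.cons_induction with
  | singleton a =>
    refine ⟨ContinuousMap.const X a, ?_⟩
    ext n
    simp only [ContinuousMap.const_apply, mem_image, mem_ofPred_eq, Finset.coe_singleton,
      mem_singleton_iff]
    exact ⟨fun ⟨x, _, h⟩ => h.symm, fun h => ⟨x₀, rfl, h.symm⟩⟩
  | cons v V hv hVne ih =>
    obtain ⟨f₀, hf₀⟩ := ih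
    obtain ⟨v₀, hv₀⟩ := hVne
    obtain ⟨x, hxd, hxf⟩ : v₀ ∈ f₀ '' {x | d x = d x₀} := by rw [hf₀]; exact hv₀
    obtain ⟨u, hu⟩ := hX.separates
    obtain ⟨s, hs, hsx⟩ := hX.perfect x
    have hev : ∀ c : C(X, ℕ), ∀ᶠ n in atTop, c (s n) = c x := fun c =>
      hs.eventually (eventually_coloring_eq c x)
    obtain ⟨n, hnd, hnf⟩ := ((hev d).and (hev f₀)).exists
    obtain ⟨i, hi⟩ : ∃ i, u i (s n) ≠ u i x := by
      by_contra h
      push Not at h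
      exact hsx n (hu _ _ h)
    let f : X → ℕ := fun y =>
      if d y = d x₀ ∧ f₀ y = v₀ ∧ u i y = u i (s n) then v else f₀ y
    have hf : Continuous f :=
      (continuous_of_discreteTopology (f := fun q : ℕ × ℕ × ℕ =>
        if q.1 = d x₀ ∧ q.2.1 = v₀ ∧ q.2.2 = u i (s n) then v else q.2.1)).comp
        (d.continuous.prodMk (f₀.continuous.prodMk (u i).continuous))
    refine ⟨⟨f, hf⟩, ?_⟩
    ext m
    simp only [ContinuousMap.coe_mk, mem_image, mem_ofPred_eq, Finset.cons_eq_insert,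
      Finset.coe_insert, mem_insert_iff, f]
    have hf₀' : ∀ m, m ∈ (V : Set ℕ) ↔ ∃ y, d y = d x₀ ∧ f₀ y = m := fun m => by
      rw [← hf₀]; rfl
    constructor
    · rintro ⟨y, hy, rfl⟩
      split_ifs with h
      · exact Or.inl rfl
      · exact Or.inr ((hf₀' _).2 ⟨y, hy, rfl⟩)
    · rintro (rfl | hm)
      · exact ⟨s n, hnd.trans hxd, if_pos ⟨hnd.trans hxd, hnf.trans hxf, rfl⟩⟩
      · by_cases hmv : m = v₀
        · subst hmv
          exact ⟨x, hxd, by rw [if_neg fun h => hi h.2.2.symm, hxf]⟩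
        · obtain ⟨y, hy, rfl⟩ := (hf₀' m).1 hm
          exact ⟨y, hy, by rw [if_neg fun h => hmv h.2.1]⟩

theorem CantorLike.exists_range_pairColoring {X X' : Type} [TopologicalSpace X]
    [TopologicalSpace X'] [CompactSpace X] (hX' : CantorLike X') (c c₁ : C(X, ℕ)) (d : C(X', ℕ))
    (h : range c = range d) :
    ∃ d₁, range (pairColoring c c₁) = range (pairColoring d d₁) := by
  classical
  have hfib : ∀ a, ∃ f : C(X', ℕ), f '' {x | d x = a} = c₁ '' {x | c x = a} := by
    intro a
    by_cases ha : a ∈ range d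
    · obtain ⟨x₀, rfl⟩ := ha
      have hfin : (c₁ '' {x | c x = d x₀}).Finite :=
        (finite_range_coloring c₁).subset (image_subset_range _ _)
      have hne : hfin.toFinset.Nonempty := by
        rw [hfin.toFinset_nonempty]
        obtain ⟨x, hx⟩ : d x₀ ∈ range c := h ▸ mem_range_self x₀
        exact ⟨_, x, hx, rfl⟩
      simpa using hX'.exists_image_fiber d x₀ hfin.toFinset hne
    · refine ⟨ContinuousMap.const X' 0, ?_⟩
      have h1 : {x | d x = a} = ∅ := by
        ext x
        simp only [mem_ofPred_eq, mem_empty_iff_false, iff_false]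
        rintro rfl
        exact ha (mem_range_self x)
      have h2 : {x | c x = a} = ∅ := by
        ext x
        simp only [mem_ofPred_eq, mem_empty_iff_false, iff_false]
        rintro rfl
        exact ha (h ▸ mem_range_self x)
      rw [h1, h2, image_empty, image_empty]
  choose f hf using hfib
  have hcont : Continuous fun x => f (d x) x := by
    rw [continuous_iff_continuousAt]
    intro x
    exact ((f (d x)).continuous.continuousAt).congr
      ((eventually_coloring_eq d x).mono fun y hy => by simp only [hy])
  refine ⟨⟨fun x => f (d x) x, hcont⟩, ?_⟩
  ext m
  constructor
  · rintro ⟨x, rfl⟩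
    have : c₁ x ∈ f (c x) '' {y | d y = c x} := by
      rw [hf]
      exact ⟨x, rfl, rfl⟩
    obtain ⟨y, hy, hy'⟩ := this
    simp only [mem_ofPred_eq] at hy
    exact ⟨y, by simp [pairColoring_apply, hy, hy']⟩
  · rintro ⟨y, rfl⟩
    have : f (d y) y ∈ c₁ '' {x | c x = d y} := by
      rw [← hf]
      exact ⟨y, rfl, rfl⟩
    obtain ⟨x, hx, hx'⟩ := this
    simp only [mem_ofPred_eq] at hx
    exact ⟨x, by simp [pairColoring_apply, hx, hx']⟩

theorem names_id_eq_iff {X X' : Type} [TopologicalSpace X] [TopologicalSpace X']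
    (c : C(X, ℕ)) (d : C(X', ℕ)) :
    names (fun _ : Unit => ContinuousMap.id X) c = names (fun _ : Unit => ContinuousMap.id X') d ↔
      range c = range d := by
  have key : ∀ {Y : Type} [TopologicalSpace Y] (c : C(Y, ℕ)),
      names (fun _ : Unit => ContinuousMap.id Y) c = (fun n _ => n) '' range c := by
    intro Y _ c
    rw [← range_comp]
    rfl
  rw [key, key]
  exact (image_injective.2 fun a b h => congrFun h ()).eq_iff

/-- Brouwer's theorem, relative to a coloring. -/
theorem CantorLike.exists_homeomorph {X X' : Type} [TopologicalSpace X] [TopologicalSpace X']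
    (hX : CantorLike X) (hX' : CantorLike X') (c : C(X, ℕ)) (d : C(X', ℕ))
    (h : range c = range d) : ∃ φ : X ≃ₜ X', ∀ x, d (φ x) = c x := by
  obtain ⟨u, hu⟩ := hX.separates
  obtain ⟨v, hv⟩ := hX'.separates
  have := hX.compact
  have := hX'.compact
  obtain ⟨φ, hφ, -⟩ := exists_conjugacy_of_back_and_forth hu hv
    (fun _ : Unit => ContinuousMap.id X) (fun _ : Unit => ContinuousMap.id X') () rfl rfl
    (fun c d h c₁ => by
      rw [names_id_eq_iff] at h
      simp only [names_id_eq_iff]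
      exact hX'.exists_range_pairColoring c c₁ d h)
    (fun c d h d₁ => by
      rw [names_id_eq_iff] at h
      simp only [names_id_eq_iff]
      obtain ⟨c₁, hc₁⟩ := hX.exists_range_pairColoring d d₁ c h.symm
      exact ⟨c₁, hc₁.symm⟩)
    c d ((names_id_eq_iff c d).2 h)
  exact ⟨φ, hφ⟩

/-! ### The Cantor space and the space of actions -/

/-- The `n`-th coordinate of the Cantor space as a coloring. -/
def coordColoring (n : ℕ) : C(Cantor, ℕ) :=
  ⟨fun x => (x n).toNat, (continuous_of_discreteTopology (f := Bool.toNat)).comp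
    (continuous_apply n)⟩

theorem separates_coordColoring : Separates coordColoring := fun x y h => by
  funext n
  have : (x n).toNat = (y n).toNat := h n
  revert this
  cases x n <;> cases y n <;> simp

/-- Switch the `n`-th coordinate. -/
def flipAt (x : Cantor) (n : ℕ) : Cantor := Function.update x n (!x n)

theorem flipAt_ne (x : Cantor) (n : ℕ) : flipAt x n ≠ x := fun h => by
  have := congrFun h n
  simp [flipAt] at this

theorem tendsto_flipAt (x : Cantor) : Tendsto (flipAt x) atTop (𝓝 x) := by
  rw [tendsto_pi_nhds]
  intro i
  refine tendsto_const_nhds.congr' ?_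
  filter_upwards [eventually_gt_atTop i] with n hn
  simp [flipAt, hn.ne]

theorem cantorLike_cantor : CantorLike Cantor :=
  ⟨inferInstance, ⟨_, separates_coordColoring⟩, fun x => ⟨flipAt x, tendsto_flipAt x, flipAt_ne x⟩⟩

theorem isOpen_coloring_comp_eq {X Y : Type} [TopologicalSpace X] [TopologicalSpace Y]
    [CompactSpace X] (c : C(Y, ℕ)) (f : C(X, Y)) :
    IsOpen {g : C(X, Y) | ∀ x, c (g x) = c (f x)} := by
  have : {g : C(X, Y) | ∀ x, c (g x) = c (f x)} =
      ⋂ a ∈ range (c.comp f), {g : C(X, Y) | MapsTo g {x | c (f x) = a} {y | c y = a}} := by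
    ext g
    simp only [mem_ofPred_eq, mem_iInter]
    exact ⟨fun h a _ x hx => (h x).trans hx, fun h x => h _ (mem_range_self x) rfl⟩
  rw [this]
  refine (finite_range_coloring _).isOpen_biInter fun a _ => ?_
  refine ContinuousMap.isOpen_setOfPred_mapsTo ?_ ?_
  · exact ((isClosed_discrete {a}).preimage (c.comp f).continuous).isCompact
  · exact (isOpen_discrete {a}).preimage c.continuous

instance countable_coloring : Countable C(Cantor, ℕ) := by
  have : DiscreteTopology C(Cantor, ℕ) := by
    refine discreteTopology_iff_isOpen_singleton.2 fun f => ?_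
    convert isOpen_coloring_comp_eq (ContinuousMap.id ℕ) f using 1
    ext g
    simp [ContinuousMap.ext_iff]
  exact TopologicalSpace.separableSpace_iff_countable.1 inferInstance

theorem exists_coloring_of_isOpen {W : Set C(Cantor, Cantor)} (hW : IsOpen W) :
    ∀ f ∈ W, ∃ c : C(Cantor, ℕ), ∀ g : C(Cantor, Cantor), (∀ x, c (g x) = c (f x)) → g ∈ W := by
  rw [ContinuousMap.compactOpen_eq] at hW
  induction hW with
  | basic s hs =>
    obtain ⟨K, hK, U, hU, rfl⟩ := hs
    intro f hf
    have hcl : IsClosed ((Uᶜ : Set Cantor) ×ˢ (f '' K)) :=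
      (IsOpen.isClosed_compl (s := U) hU).prod (IsCompact.image hK f.continuous).isClosed
    obtain ⟨c, hc⟩ := separates_coordColoring.exists_coloring hcl (by
      rintro x ⟨hx, y, hy, rfl⟩
      exact hx (hf hy))
    refine ⟨c, fun g hg x hx => ?_⟩
    by_contra hgx
    exact hc _ _ (hg x) ⟨hgx, x, hx, rfl⟩
  | univ => exact fun f _ => ⟨ContinuousMap.const _ 0, fun g _ => mem_univ g⟩
  | inter s t _ _ hs ht =>
    rintro f ⟨hfs, hft⟩
    obtain ⟨c, hc⟩ := hs f hfs
    obtain ⟨d, hd⟩ := ht f hft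
    exact ⟨pairColoring c d, fun g hg => ⟨hc g fun x => ((pairColoring_eq_iff _ _ _ _).1 (hg x)).1,
      hd g fun x => ((pairColoring_eq_iff _ _ _ _).1 (hg x)).2⟩⟩
  | sUnion S _ ih =>
    rintro f ⟨s, hs, hfs⟩
    obtain ⟨c, hc⟩ := ih s hs f hfs
    exact ⟨c, fun g hg => ⟨s, hs, hc g hg⟩⟩

section Actions

variable {G : Type} [Group G]

/-- The actions which agree with `α` on `S` as far as the coloring `c` can see. -/
def agreeSet (α : ActSpace G) (S : Finset G) (c : C(Cantor, ℕ)) : Set (ActSpace G) :=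
  {β | ∀ s ∈ S, ∀ x, c (β.1 s x) = c (α.1 s x)}

theorem mem_agreeSet_self (α : ActSpace G) (S : Finset G) (c : C(Cantor, ℕ)) :
    α ∈ agreeSet α S c := fun _ _ _ => rfl

theorem isOpen_agreeSet (α : ActSpace G) (S : Finset G) (c : C(Cantor, ℕ)) :
    IsOpen (agreeSet α S c) := by
  have : agreeSet α S c =
      ⋂ s ∈ S, (fun β : ActSpace G => β.1 s) ⁻¹' {g | ∀ x, c (g x) = c (α.1 s x)} := by
    ext β
    simp [agreeSet]
  rw [this]
  exact isOpen_biInter_finset fun s _ => (isOpen_coloring_comp_eq c (α.1 s)).preimage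
    ((continuous_apply s).comp continuous_subtype_val)

theorem exists_agreeSet_subset {O : Set (ActSpace G)} (hO : IsOpen O) {α : ActSpace G}
    (hα : α ∈ O) : ∃ S c, agreeSet α S c ⊆ O := by
  obtain ⟨O', hO', rfl⟩ := isOpen_induced_iff.1 hO
  obtain ⟨S, u, hu, hS⟩ := isOpen_pi_iff.1 hO' α.1 hα
  choose! c hc using fun s (hs : s ∈ S) => exists_coloring_of_isOpen (hu s hs).1 _ (hu s hs).2
  obtain ⟨d, hd⟩ := exists_coloring_forall_finset c S
  exact ⟨S, d, fun β hβ => hS fun s hs => hc s hs _ fun x => (hd _ _).1 (hβ s hs x) s hs⟩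

theorem exists_refining_coloring (α : ActSpace G) (S : Finset G) (c : C(Cantor, ℕ)) :
    ∃ e : C(Cantor, ℕ), (∀ x y, e x = e y → c x = c y) ∧
      ∀ s ∈ S, ∀ x y, e x = e y → c (α.1 s x) = c (α.1 s y) := by
  obtain ⟨e, he⟩ := exists_coloring_forall_finset (fun s => c.comp (α.1 s)) S
  refine ⟨pairColoring c e, fun x y h => ((pairColoring_eq_iff _ _ _ _).1 h).1,
    fun s hs x y h => ?_⟩
  exact (he x y).1 ((pairColoring_eq_iff _ _ _ _).1 h).2 s hs

/-- Transport an action to the Cantor space along a homeomorphism. -/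
def conjAction {X : Type} [TopologicalSpace X] (γ : G → C(X, X))
    (h₁ : γ 1 = ContinuousMap.id X) (hm : ∀ g k, γ (g * k) = (γ g).comp (γ k))
    (φ : X ≃ₜ Cantor) : ActSpace G :=
  ⟨fun g => (φ : C(X, Cantor)).comp ((γ g).comp (φ.symm : C(Cantor, X))), by
    constructor
    · ext1 x
      simp [h₁]
    · intro g k
      ext1 x
      simp [hm]⟩

theorem conjAction_apply {X : Type} [TopologicalSpace X] (γ : G → C(X, X))
    (h₁ : γ 1 = ContinuousMap.id X) (hm : ∀ g k, γ (g * k) = (γ g).comp (γ k))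
    (φ : X ≃ₜ Cantor) (g : G) (x : Cantor) :
    (conjAction γ h₁ hm φ).1 g x = φ (γ g (φ.symm x)) := rfl

/-- Conjugation of an action on the Cantor space by a homeomorphism. -/
def conjBy (φ : Cantor ≃ₜ Cantor) (α : ActSpace G) : ActSpace G :=
  conjAction α.1 α.2.1 α.2.2 φ

theorem conjBy_apply (φ : Cantor ≃ₜ Cantor) (α : ActSpace G) (g : G) (x : Cantor) :
    (conjBy φ α).1 g x = φ (α.1 g (φ.symm x)) := rfl

theorem continuous_conjBy (φ : Cantor ≃ₜ Cantor) :
    Continuous (conjBy φ : ActSpace G → ActSpace G) := by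
  refine Continuous.subtype_mk (continuous_pi fun g => ?_) _
  exact (ContinuousMap.continuous_postcomp _).comp ((ContinuousMap.continuous_precomp _).comp
    ((continuous_apply g).comp continuous_subtype_val))

theorem names_conjBy (φ : Cantor ≃ₜ Cantor) (α : ActSpace G) (c : C(Cantor, ℕ)) :
    names (conjBy φ α).1 c = names α.1 (c.comp (φ : C(Cantor, Cantor))) := by
  have : (fun (x : Cantor) (g : G) => (c.comp (φ : C(Cantor, Cantor))) (α.1 g x)) =
      (fun x g => c ((conjBy φ α).1 g x)) ∘ φ := by
    funext x g
    simp [conjBy_apply]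
  unfold names
  rw [this, φ.surjective.range_comp]

/-- An extension of `α` can be realized on the Cantor space arbitrarily close to `α`. -/
theorem exists_conjAction_mem {X : Type} [TopologicalSpace X] (hX : CantorLike X)
    (γ : G → C(X, X)) (h₁ : γ 1 = ContinuousMap.id X)
    (hm : ∀ g k, γ (g * k) = (γ g).comp (γ k)) (α : ActSpace G) (q : C(X, Cantor))
    (hq : Function.Surjective q) (hqγ : ∀ g x, q (γ g x) = α.1 g (q x)) (e : C(Cantor, ℕ))
    {O : Set (ActSpace G)} (hO : IsOpen O) (hα : α ∈ O) :
    ∃ φ : X ≃ₜ Cantor, (∀ x, e (φ x) = e (q x)) ∧ conjAction γ h₁ hm φ ∈ O := by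
  obtain ⟨S, c, hS⟩ := exists_agreeSet_subset hO hα
  obtain ⟨e', hce, hαe⟩ := exists_refining_coloring α S c
  obtain ⟨φ, hφ⟩ := hX.exists_homeomorph cantorLike_cantor ((pairColoring e e').comp q)
    (pairColoring e e') (by
      rw [ContinuousMap.coe_comp, hq.range_comp])
  have hφ' : ∀ x, e (φ x) = e (q x) ∧ e' (φ x) = e' (q x) := fun x =>
    (pairColoring_eq_iff _ _ _ _).1 (hφ x)
  refine ⟨φ, fun x => (hφ' x).1, hS fun s hs x => ?_⟩
  rw [conjAction_apply]
  calc c (φ (γ s (φ.symm x))) = c (q (γ s (φ.symm x))) := hce _ _ (hφ' _).2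
    _ = c (α.1 s (q (φ.symm x))) := by rw [hqγ]
    _ = c (α.1 s (φ (φ.symm x))) := (hαe s hs _ _ (hφ' _).2).symm
    _ = c (α.1 s x) := by rw [φ.apply_symm_apply]

theorem cantorLike_of_isClosed (F : Set (Cantor × Cantor)) (hF : IsClosed F) :
    CantorLike (F × Cantor) := by
  refine ⟨?_, ⟨fun n => pairColoring
      ((coordColoring n).comp ⟨fun p => p.1.1.1, by fun_prop⟩) (pairColoring
      ((coordColoring n).comp ⟨fun p => p.1.1.2, by fun_prop⟩)
      ((coordColoring n).comp ⟨fun p => p.2, by fun_prop⟩)), ?_⟩, ?_⟩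
  · have := isCompact_iff_compactSpace.1 hF.isCompact
    infer_instance
  · rintro ⟨⟨⟨a, b⟩, h⟩, t⟩ ⟨⟨⟨a', b'⟩, h'⟩, t'⟩ heq
    simp only [pairColoring_eq_iff] at heq
    obtain rfl := separates_coordColoring a a' fun n => (heq n).1
    obtain rfl := separates_coordColoring b b' fun n => (heq n).2.1
    obtain rfl := separates_coordColoring t t' fun n => (heq n).2.2
    rfl
  · rintro ⟨p, t⟩
    exact ⟨fun n => (p, flipAt t n), tendsto_const_nhds.prodMk_nhds (tendsto_flipAt t),
      fun n h => flipAt_ne t n (Prod.ext_iff.1 h).2⟩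

/-- Amalgamation: actions with a common factor have conjugates, compatible with the factor,
close to each of them. -/
theorem exists_amalgam (α β : ActSpace G) (c d : C(Cantor, ℕ)) (h : names α.1 c = names β.1 d)
    {O₁ O₂ : Set (ActSpace G)} (hO₁ : IsOpen O₁) (hα : α ∈ O₁) (hO₂ : IsOpen O₂) (hβ : β ∈ O₂) :
    ∃ β' ∈ O₂, ∃ φ : Cantor ≃ₜ Cantor, conjBy φ β' ∈ O₁ ∧
      c.comp (φ : C(Cantor, Cantor)) = d := by
  let F : Set (Cantor × Cantor) := {p | ∀ g, c (α.1 g p.1) = d (β.1 g p.2)}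
  have hF : IsClosed F := by
    have : F = ⋂ g, {p | c (α.1 g p.1) = d (β.1 g p.2)} := by
      ext p
      simp [F]
    rw [this]
    exact isClosed_iInter fun g => isClosed_eq (by fun_prop) (by fun_prop)
  have hX := cantorLike_of_isClosed F hF
  let γ : G → C(F × Cantor, F × Cantor) := fun g =>
    ⟨fun p => (⟨(α.1 g p.1.1.1, β.1 g p.1.1.2), fun k => by
      have := p.1.2 (k * g)
      rw [α.2.2, β.2.2] at this
      exact this⟩, p.2), by fun_prop⟩
  have h₁ : γ 1 = ContinuousMap.id _ := by
    ext1 p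
    simp [γ, α.2.1, β.2.1]
  have hm : ∀ g k, γ (g * k) = (γ g).comp (γ k) := by
    intro g k
    ext1 p
    simp [γ, α.2.2, β.2.2]
  obtain ⟨φ₁, hφ₁, hmem₁⟩ := exists_conjAction_mem hX γ h₁ hm α ⟨fun p => p.1.1.1, by fun_prop⟩
    (fun x => by
      obtain ⟨y, hy⟩ : (fun g => c (α.1 g x)) ∈ names β.1 d := h ▸ mem_range_self x
      exact ⟨(⟨(x, y), fun g => (congrFun hy g).symm⟩, x), rfl⟩)
    (fun g p => rfl) c hO₁ hα
  obtain ⟨φ₂, hφ₂, hmem₂⟩ := exists_conjAction_mem hX γ h₁ hm β ⟨fun p => p.1.1.2, by fun_prop⟩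
    (fun y => by
      obtain ⟨x, hx⟩ : (fun g => d (β.1 g y)) ∈ names α.1 c := h ▸ mem_range_self y
      exact ⟨(⟨(x, y), fun g => congrFun hx g⟩, x), rfl⟩)
    (fun g p => rfl) d hO₂ hβ
  refine ⟨_, hmem₂, φ₂.symm.trans φ₁, ?_, ?_⟩
  · convert hmem₁ using 1
    apply Subtype.ext
    funext g
    ext1 x
    simp [conjBy_apply, conjAction_apply]
  · ext y
    have h1 := hφ₁ (φ₂.symm y)
    have h2 := hφ₂ (φ₂.symm y)
    have h3 := (φ₂.symm y).1.2 1
    simp only [α.2.1, β.2.1, ContinuousMap.id_apply] at h3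
    rw [φ₂.apply_symm_apply] at h2
    simp only [ContinuousMap.coe_mk] at h1 h2
    change c (φ₁ (φ₂.symm y)) = d y
    rw [h1, h2, h3]

end Actions

/-! ### Shadowing -/

section Shadowing

variable {G : Type} [Group G]

/-- Shadowing, expressed through colorings instead of a metric. -/
def ShadowsColorings (α : ActSpace G) : Prop :=
  ∀ u : C(Cantor, ℕ), ∃ (v : C(Cantor, ℕ)) (S : Finset G), ∀ x : G → Cantor,
    (∀ g, ∀ s ∈ S, v (α.1 s (x g)) = v (x (s * g))) → ∃ y, ∀ g, u (x g) = u (α.1 g y)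

theorem exists_coloring_dist_lt (m : MetricSpace Cantor)
    (hcompat : m.toUniformSpace.toTopologicalSpace = (inferInstance : TopologicalSpace Cantor))
    {ε : ℝ} (hε : 0 < ε) : ∃ c : C(Cantor, ℕ), ∀ x y, c x = c y → m.dist x y < ε := by
  have hcont : Continuous fun p : Cantor × Cantor => m.dist p.1 p.2 := by
    have := @continuous_dist Cantor m.toPseudoMetricSpace
    rw [hcompat] at this
    exact this
  obtain ⟨c, hc⟩ := separates_coordColoring.exists_coloring
    (K := {p | ε ≤ m.dist p.1 p.2}) (isClosed_le continuous_const hcont) (fun x hx => by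
      have : m.dist x x = 0 := m.dist_self x
      simp only [mem_ofPred_eq, this] at hx
      exact hx.not_gt hε)
  exact ⟨c, fun x y h => not_le.1 (hc x y h)⟩

theorem exists_pos_forall_dist_lt (m : MetricSpace Cantor)
    (hcompat : m.toUniformSpace.toTopologicalSpace = (inferInstance : TopologicalSpace Cantor))
    (c : C(Cantor, ℕ)) : ∃ δ : ℝ, 0 < δ ∧ ∀ x y, m.dist x y < δ → c x = c y := by
  have hcont : Continuous fun p : Cantor × Cantor => m.dist p.1 p.2 := by
    have := @continuous_dist Cantor m.toPseudoMetricSpace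
    rw [hcompat] at this
    exact this
  have hcomp : IsCompact {p : Cantor × Cantor | c p.1 ≠ c p.2} := (isClosed_coloring_ne c).isCompact
  rcases {p : Cantor × Cantor | c p.1 ≠ c p.2}.eq_empty_or_nonempty with he | hne
  · refine ⟨1, one_pos, fun x y _ => ?_⟩
    by_contra h
    have : (x, y) ∈ {p : Cantor × Cantor | c p.1 ≠ c p.2} := h
    rw [he] at this
    exact this
  · obtain ⟨p, hp, hmin⟩ := hcomp.exists_isMinOn hne hcont.continuousOn
    refine ⟨m.dist p.1 p.2, ?_, fun x y hxy => ?_⟩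
    · refine (@dist_pos Cantor m p.1 p.2).2 fun h => hp ?_
      rw [h]
    · by_contra h
      exact hxy.not_ge (hmin (show (x, y) ∈ _ from h))

theorem hasShadowing_iff (m : MetricSpace Cantor)
    (hcompat : m.toUniformSpace.toTopologicalSpace = (inferInstance : TopologicalSpace Cantor))
    (α : ActSpace G) :
    HasShadowing (fun x y => m.dist x y) (fun g z => α.1 g z) ↔ ShadowsColorings α := by
  constructor
  · intro h u
    obtain ⟨ε, hε, hu⟩ := exists_pos_forall_dist_lt m hcompat u
    obtain ⟨δ, S, hδ, hS⟩ := h ε hε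
    obtain ⟨v, hv⟩ := exists_coloring_dist_lt m hcompat hδ
    refine ⟨v, S, fun x hx => ?_⟩
    obtain ⟨y, hy⟩ := hS x fun g s hs => hv _ _ (hx g s hs)
    exact ⟨y, fun g => hu _ _ (hy g)⟩
  · intro h ε hε
    obtain ⟨u, hu⟩ := exists_coloring_dist_lt m hcompat hε
    obtain ⟨v, S, hS⟩ := h u
    obtain ⟨δ, hδ, hv⟩ := exists_pos_forall_dist_lt m hcompat v
    refine ⟨δ, S, hδ, fun x hx => ?_⟩
    obtain ⟨y, hy⟩ := hS x fun g s hs => hv _ _ (hx g s hs)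
    exact ⟨y, fun g => hu _ _ (hy g)⟩

/-- The subshift of finite type approximating the `e`-names of `α`, times a full shift. -/
def approxShift (α : ActSpace G) (S : Finset G) (e : C(Cantor, ℕ)) : Set (G → ℕ → ℕ) :=
  {w | (∀ g, ∀ s ∈ S, ∃ x, e x = w g 0 ∧ e (α.1 s x) = w (s * g) 0) ∧ ∀ g j, w g (j + 1) ≤ 1}

/-- The coordinates of `approxShift` as colorings. -/
def approxShiftCoord (α : ActSpace G) (S : Finset G) (e : C(Cantor, ℕ)) (i : G × ℕ) :
    C(approxShift α S e, ℕ) :=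
  ⟨fun w => w.1 i.1 i.2,
    (continuous_apply i.2).comp ((continuous_apply i.1).comp continuous_subtype_val)⟩

theorem separates_approxShiftCoord (α : ActSpace G) (S : Finset G) (e : C(Cantor, ℕ)) :
    Separates (approxShiftCoord α S e) := fun x y h => by
  ext g j
  exact h (g, j)

theorem isClosed_approxShift (α : ActSpace G) (S : Finset G) (e : C(Cantor, ℕ)) :
    IsClosed (approxShift α S e) := by
  have : approxShift α S e = (⋂ g, ⋂ s ∈ S, (fun w : G → ℕ → ℕ => (w g 0, w (s * g) 0)) ⁻¹'
      {p | ∃ x, e x = p.1 ∧ e (α.1 s x) = p.2}) ∩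
      ⋂ g, ⋂ j, (fun w : G → ℕ → ℕ => w g (j + 1)) ⁻¹' {n | n ≤ 1} := by
    ext w
    simp [approxShift]
  rw [this]
  refine IsClosed.inter ?_ ?_
  · exact isClosed_iInter fun g => isClosed_biInter fun s _ =>
      (isClosed_discrete _).preimage (by fun_prop)
  · exact isClosed_iInter fun g => isClosed_iInter fun j =>
      (isClosed_discrete _).preimage (by fun_prop)

theorem compactSpace_approxShift (α : ActSpace G) {S : Finset G} (hS : 1 ∈ S)
    (e : C(Cantor, ℕ)) : CompactSpace (approxShift α S e) := by
  rw [← isCompact_iff_compactSpace]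
  have hK : IsCompact (univ.pi fun _ : G => univ.pi fun _ : ℕ => range e ∪ Iic 1) :=
    isCompact_univ_pi fun _ => isCompact_univ_pi fun _ =>
      ((finite_range_coloring e).union (finite_Iic 1)).isCompact
  refine hK.of_isClosed_subset (isClosed_approxShift α S e) ?_
  rintro w ⟨hw, hw'⟩ g - j -
  cases j with
  | zero =>
    obtain ⟨x, hx, -⟩ := hw g 1 hS
    exact Or.inl ⟨x, hx⟩
  | succ j => exact Or.inr (hw' g j)

theorem cantorLike_approxShift [Countable G] (α : ActSpace G) {S : Finset G} (hS : 1 ∈ S)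
    (e : C(Cantor, ℕ)) : CantorLike (approxShift α S e) := by
  classical
  refine ⟨compactSpace_approxShift α hS e, ?_, fun w => ?_⟩
  · obtain ⟨f, hf⟩ := exists_surjective_nat (G × ℕ)
    refine ⟨fun n => approxShiftCoord α S e (f n), fun x y h =>
      separates_approxShiftCoord α S e x y fun i => ?_⟩
    obtain ⟨n, rfl⟩ := hf i
    exact h n
  · let f : ℕ → G → ℕ → ℕ := fun n g j =>
      if g = 1 ∧ j = n + 1 then 1 - w.1 g j else w.1 g j
    have hf0 : ∀ n g, f n g 0 = w.1 g 0 := fun n g => by simp [f]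
    refine ⟨fun n => ⟨f n, ?_, fun g j => ?_⟩, ?_, fun n h => ?_⟩
    · simp only [hf0]
      exact w.2.1
    · simp only [f]
      split_ifs
      · exact Nat.sub_le _ _
      · exact w.2.2 g j
    · rw [tendsto_subtype_rng, tendsto_pi_nhds]
      intro g
      rw [tendsto_pi_nhds]
      intro j
      refine tendsto_const_nhds.congr' ?_
      filter_upwards [eventually_gt_atTop j] with n hn
      have : ¬ (g = 1 ∧ j = n + 1) := by omega
      simp only [f, if_neg this]
    · have h1 := congrFun (congrFun (Subtype.ext_iff.1 h) 1) (n + 1)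
      have h2 := w.2.2 1 n
      simp only [f, and_self, if_true] at h1
      omega

/-- The shift action on `approxShift`. -/
def approxShiftAction (α : ActSpace G) (S : Finset G) (e : C(Cantor, ℕ)) (k : G) :
    C(approxShift α S e, approxShift α S e) :=
  ⟨fun w => ⟨fun g => w.1 (g * k), fun g s hs => by
    have := w.2.1 (g * k) s hs
    rwa [← mul_assoc] at this, fun g j => w.2.2 _ j⟩,
    Continuous.subtype_mk (f := fun (w : approxShift α S e) (g : G) => w.1 (g * k))
      (continuous_pi fun g => (continuous_apply (g * k)).comp continuous_subtype_val) _⟩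

theorem dense_shadowsColorings [Countable G] : Dense {α : ActSpace G | ShadowsColorings α} := by
  classical
  intro α
  rw [mem_closure_iff]
  intro O hO hα
  obtain ⟨S₀, c, hSO⟩ := exists_agreeSet_subset hO hα
  obtain ⟨e, hce, hαe⟩ := exists_refining_coloring α S₀ c
  let S := insert 1 S₀
  have hS : 1 ∈ S := Finset.mem_insert_self _ _
  let γ := approxShiftAction α S e
  have h₁ : γ 1 = ContinuousMap.id _ := by
    ext1 w
    apply Subtype.ext
    funext g
    simp [γ, approxShiftAction]
  have hm : ∀ g k, γ (g * k) = (γ g).comp (γ k) := by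
    intro g k
    ext1 w
    apply Subtype.ext
    funext l
    simp [γ, approxShiftAction, mul_assoc]
  have hX := cantorLike_approxShift α hS e
  have := hX.compact
  obtain ⟨φ, hφ⟩ := hX.exists_homeomorph cantorLike_cantor (approxShiftCoord α S e (1, 0)) e (by
    ext n
    constructor
    · rintro ⟨w, rfl⟩
      obtain ⟨x, hx, -⟩ := w.2.1 1 1 hS
      exact ⟨x, hx⟩
    · rintro ⟨x, rfl⟩
      refine ⟨⟨fun g j => if j = 0 then e (α.1 g x) else 0, fun g s _ => ⟨α.1 g x, ?_, ?_⟩, ?_⟩, ?_⟩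
      · simp
      · simp [α.2.2]
      · simp
      · simp [approxShiftCoord, α.2.1])
  refine ⟨conjAction γ h₁ hm φ, hSO fun s hs x => ?_, fun u => ?_⟩
  · obtain ⟨z, hz, hz'⟩ := (φ.symm x).2.1 1 s (Finset.mem_insert_of_mem hs)
    have h2 : e (φ (γ s (φ.symm x))) = e (α.1 s z) := by
      rw [hφ, hz']
      simp [γ, approxShiftAction, approxShiftCoord]
    have h3 : e z = e x := by
      rw [hz, ← φ.apply_symm_apply x, hφ, φ.symm_apply_apply]
      rfl
    rw [conjAction_apply]
    exact (hce _ _ h2).trans (hαe s hs _ _ h3)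
  · obtain ⟨t, ht⟩ := (separates_approxShiftCoord α S e).exists_finset
      (isClosed_coloring_ne (u.comp (φ : C(approxShift α S e, Cantor)))) (fun w h => h rfl)
    obtain ⟨v, hv⟩ := exists_coloring_forall_finset
      (fun j => (approxShiftCoord α S e (1, j)).comp (φ.symm : C(Cantor, approxShift α S e)))
      (insert 0 (t.image Prod.snd))
    refine ⟨v, S ∪ t.image Prod.fst, fun x hx => ?_⟩
    have key : ∀ g, ∀ s ∈ S ∪ t.image Prod.fst, ∀ j ∈ insert 0 (t.image Prod.snd),
        (φ.symm (x g)).1 s j = (φ.symm (x (s * g))).1 1 j := by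
      intro g s hs j hj
      have := (hv _ _).1 (hx g s hs) j hj
      simpa [conjAction_apply, approxShiftCoord, γ, approxShiftAction] using this
    let w : approxShift α S e := ⟨fun g j => (φ.symm (x g)).1 1 j, fun g s hs => by
        change ∃ z, e z = (φ.symm (x g)).1 1 0 ∧ e (α.1 s z) = (φ.symm (x (s * g))).1 1 0
        rw [← key g s (Finset.mem_union_left _ hs) 0 (Finset.mem_insert_self _ _)]
        have := (φ.symm (x g)).2.1 1 s hs
        rwa [mul_one] at this, fun g j => (φ.symm (x g)).2.2 1 j⟩
    refine ⟨φ w, fun g => ?_⟩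
    have := ht (φ.symm (x g)) (γ g w) fun i hi => by
      have := key g i.1 (Finset.mem_union_right _ (Finset.mem_image_of_mem _ hi)) i.2
        (Finset.mem_insert_of_mem (Finset.mem_image_of_mem _ hi))
      simpa [approxShiftCoord, γ, approxShiftAction, w] using this
    simpa [conjAction_apply] using this

end Shadowing

/-! ### Generic actions -/

section Generic

variable {G : Type} [Group G]

/-- The actions near which the set of names for the coloring `c` is constant. -/
def stableSet (c : C(Cantor, ℕ)) : Set (ActSpace G) :=
  {α | ∀ᶠ β in 𝓝 α, names β.1 c = names α.1 c}

theorem isOpen_stableSet (c : C(Cantor, ℕ)) : IsOpen (stableSet (G := G) c) := by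
  rw [isOpen_iff_eventually]
  intro α hα
  filter_upwards [hα, eventually_eventually_nhds.2 hα] with β h₁ h₂
  filter_upwards [h₂] with γ h
  rw [h, h₁]

theorem mem_closure_of_forall_finset {Γ : Type} {A : Set (Γ → ℕ)} {f : Γ → ℕ}
    (h : ∀ S : Finset Γ, ∃ z ∈ A, ∀ g ∈ S, z g = f g) : f ∈ closure A := by
  rw [mem_closure_iff]
  intro O hO hf
  obtain ⟨S, u, hu, hS⟩ := isOpen_pi_iff.1 hO f hf
  obtain ⟨z, hz, hzf⟩ := h S
  exact ⟨z, hS fun g hg => by rw [hzf g hg]; exact (hu g hg).2, hz⟩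

theorem isClosed_names {X Γ : Type} [TopologicalSpace X] [CompactSpace X] (α : Γ → C(X, X))
    (c : C(X, ℕ)) : IsClosed (names α c) :=
  (isCompact_range (continuous_name α c)).isClosed

theorem isClosed_names_eq (c : C(Cantor, ℕ)) (Z : Set (G → ℕ)) :
    IsClosed {α : ActSpace G | names α.1 c = Z} := by
  refine isClosed_of_closure_subset fun α hα => ?_
  have happ : ∀ S : Finset G, ∃ β ∈ agreeSet α S c, names β.1 c = Z := fun S =>
    mem_closure_iff.1 hα _ (isOpen_agreeSet α S c) (mem_agreeSet_self α S c)
  apply Subset.antisymm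
  · rintro _ ⟨x, rfl⟩
    have hZ : IsClosed Z := by
      obtain ⟨β, -, rfl⟩ := happ ∅
      exact isClosed_names _ _
    rw [← hZ.closure_eq]
    refine mem_closure_of_forall_finset fun S => ?_
    obtain ⟨β, hβ, rfl⟩ := happ S
    exact ⟨_, ⟨x, rfl⟩, fun g hg => hβ g hg x⟩
  · intro z hz
    rw [← (isClosed_names α.1 c).closure_eq]
    refine mem_closure_of_forall_finset fun S => ?_
    obtain ⟨β, hβ, rfl⟩ := happ S
    obtain ⟨x, rfl⟩ := hz
    exact ⟨_, ⟨x, rfl⟩, fun g hg => (hβ g hg x).symm⟩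

/-- The `c`-names of the pseudo-orbits determined by finitely many allowed transitions between
the colors of `e`. -/
def pseudoNames (c e : C(Cantor, ℕ)) (S : Finset G) (T : Finset (G × ℕ × ℕ)) : Set (G → ℕ) :=
  {z | ∃ x : G → Cantor, (∀ g, ∀ s ∈ S, (s, e (x g), e (x (s * g))) ∈ T) ∧ z = fun g => c (x g)}

theorem ShadowsColorings.exists_names_eq_pseudoNames {α : ActSpace G} (hα : ShadowsColorings α)
    (c : C(Cantor, ℕ)) : ∃ e S T, names α.1 c = pseudoNames c e S T := by
  obtain ⟨v, S, hS⟩ := hα c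
  obtain ⟨e, hve, hαe⟩ := exists_refining_coloring α S v
  have hfin : {t : G × ℕ × ℕ | t.1 ∈ S ∧ ∃ z, (e z, e (α.1 t.1 z)) = t.2}.Finite := by
    have hr := finite_range_coloring e
    refine (S.finite_toSet.prod (hr.prod hr)).subset ?_
    rintro ⟨s, p⟩ ⟨hs, z, hz⟩
    obtain rfl : (e z, e (α.1 s z)) = p := hz
    exact ⟨hs, ⟨z, rfl⟩, ⟨_, rfl⟩⟩
  refine ⟨e, S, hfin.toFinset, Subset.antisymm ?_ ?_⟩
  · rintro _ ⟨x, rfl⟩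
    refine ⟨fun g => α.1 g x, fun g s hs => ?_, rfl⟩
    rw [hfin.mem_toFinset]
    exact ⟨hs, α.1 g x, by simp [α.2.2]⟩
  · rintro _ ⟨x, hx, rfl⟩
    obtain ⟨y, hy⟩ := hS x fun g s hs => by
      obtain ⟨-, z, hz⟩ := hfin.mem_toFinset.1 (hx g s hs)
      obtain ⟨h₁, h₂⟩ := Prod.ext_iff.1 hz
      exact (hαe s hs _ _ h₁.symm).trans (hve _ _ h₂)
    exact ⟨y, funext fun g => (hy g).symm⟩

theorem isMeagre_shadowsColorings_diff [Countable G] (c : C(Cantor, ℕ)) :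
    IsMeagre ({α : ActSpace G | ShadowsColorings α} \ stableSet c) := by
  have hm : IsMeagre (⋃ i : C(Cantor, ℕ) × Finset G × Finset (G × ℕ × ℕ),
      frontier {α : ActSpace G | names α.1 c = pseudoNames c i.1 i.2.1 i.2.2}) :=
    isMeagre_iUnion fun i => IsNowhereDense.isMeagre <|
      isClosed_frontier.isNowhereDense_iff.2 (interior_frontier (isClosed_names_eq c _))
  refine hm.mono ?_
  rintro α ⟨hα, hαc⟩
  obtain ⟨e, S, T, h⟩ := ShadowsColorings.exists_names_eq_pseudoNames hα c
  refine mem_iUnion.2 ⟨(e, S, T), ?_⟩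
  rw [(isClosed_names_eq c _).frontier_eq]
  refine ⟨h, fun hint => hαc ?_⟩
  filter_upwards [mem_interior_iff_mem_nhds.1 hint] with β hβ
  exact Eq.trans hβ h.symm

theorem mem_stableSet_of_conjBy {φ : Cantor ≃ₜ Cantor} {α : ActSpace G} {c : C(Cantor, ℕ)}
    (h : α ∈ stableSet (c.comp (φ : C(Cantor, Cantor)))) : conjBy φ α ∈ stableSet c := by
  have hinv : ∀ β : ActSpace G, conjBy φ (conjBy φ.symm β) = β := fun β => by
    apply Subtype.ext
    funext g
    ext1 x
    simp [conjBy_apply]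
  have hinv' : conjBy φ.symm (conjBy φ α) = α := by
    apply Subtype.ext
    funext g
    ext1 x
    simp [conjBy_apply]
  have ht : Tendsto (conjBy φ.symm) (𝓝 (conjBy φ α)) (𝓝 α) := by
    have := (continuous_conjBy (G := G) φ.symm).tendsto (conjBy φ α)
    rwa [hinv'] at this
  filter_upwards [ht.eventually h] with β hβ
  rw [names_conjBy, ← hβ, ← names_conjBy, hinv]

theorem names_const {Γ : Type} (α : Γ → C(Cantor, Cantor)) :
    names α (ContinuousMap.const Cantor 0) = {0} :=
  range_const (c := (0 : Γ → ℕ))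

theorem names_eq_of_mem_interior {α : ActSpace G} {c : C(Cantor, ℕ)} {Z : Set (G → ℕ)}
    (h : α ∈ interior {β : ActSpace G | names β.1 c = Z}) : names α.1 c = Z := by
  have := interior_subset h
  exact this

theorem dense_stableSet [Countable G] (h : ¬ IsMeagre {α : ActSpace G | ShadowsColorings α})
    (c : C(Cantor, ℕ)) : Dense (stableSet (G := G) c) := by
  have hnm : ¬ IsMeagre (⋂ d, stableSet (G := G) d) := fun hm => h <| by
    refine (hm.union (isMeagre_iUnion fun d => isMeagre_shadowsColorings_diff d)).mono fun α hα => ?_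
    by_cases hd : ∀ d, α ∈ stableSet d
    · exact Or.inl (mem_iInter.2 hd)
    · push Not at hd
      obtain ⟨d, hd⟩ := hd
      exact Or.inr (mem_iUnion.2 ⟨d, hα, hd⟩)
  have hne : (interior (closure (⋂ d, stableSet (G := G) d))).Nonempty := by
    rw [nonempty_iff_ne_empty]
    exact fun h0 => hnm (IsNowhereDense.isMeagre h0)
  obtain ⟨α₁, hα₁⟩ := hne
  rw [dense_iff_inter_open]
  rintro V hV ⟨α₂, hα₂⟩
  obtain ⟨β, hβ, φ, hφ, -⟩ := exists_amalgam α₂ α₁ (ContinuousMap.const Cantor 0)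
    (ContinuousMap.const Cantor 0) (by rw [names_const, names_const]) hV hα₂ isOpen_interior hα₁
  obtain ⟨γ, hγV, hγ⟩ := mem_closure_iff.1 (interior_subset hβ)
    (conjBy φ ⁻¹' V) (hV.preimage (continuous_conjBy φ)) hφ
  exact ⟨conjBy φ γ, hγV, mem_stableSet_of_conjBy (mem_iInter.1 hγ _)⟩

theorem names_fstColoring {Γ : Type} (α : Γ → C(Cantor, Cantor)) (c : C(Cantor, ℕ)) :
    names α (fstColoring c) = (fun w g => (w g).unpair.1) '' names α c := by
  unfold names
  rw [← range_comp]
  rfl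

/-- The actions for which a lift of the set of `d`-names to `Z` is realized by a refinement
of `d`. -/
def liftingSet (Z : Set (G → ℕ)) (d : C(Cantor, ℕ)) : Set (ActSpace G) :=
  {β | β ∈ stableSet d → names β.1 d = (fun w g => (w g).unpair.1) '' Z →
    ∃ d₁, names β.1 (pairColoring d d₁) = Z}

/-- The sets of names shared by all members of a nonempty open set of actions. -/
def stableNames (G : Type) [Group G] : Set (Set (G → ℕ)) :=
  ⋃ c, {Z | (interior {α : ActSpace G | names α.1 c = Z}).Nonempty}

theorem liftingSet_mem_residual {Z : Set (G → ℕ)} (hZ : Z ∈ stableNames G) (d : C(Cantor, ℕ)) :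
    liftingSet Z d ∈ residual (ActSpace G) := by
  obtain ⟨c, α, hα⟩ := mem_iUnion.1 hZ
  let I := interior {β : ActSpace G | names β.1 d = (fun w g => (w g).unpair.1) '' Z}
  let J := ⋃ d₁, interior {β : ActSpace G | names β.1 (pairColoring d d₁) = Z}
  have hJ : IsOpen J := isOpen_iUnion fun _ => isOpen_interior
  have hIJ : I ⊆ closure J := by
    intro β hβ
    rw [mem_closure_iff]
    intro O hO hβO
    have hnames : names α.1 (fstColoring c) = names β.1 d := by
      rw [names_fstColoring, names_eq_of_mem_interior hα]
      exact (names_eq_of_mem_interior hβ).symm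
    obtain ⟨β', hβ', φ, hφ, hcd⟩ := exists_amalgam α β (fstColoring c) d hnames isOpen_interior hα
      hO hβO
    refine ⟨β', hβ', mem_iUnion.2 ⟨sndColoring (c.comp (φ : C(Cantor, Cantor))), ?_⟩⟩
    refine mem_interior.2 ⟨_, ?_, isOpen_interior.preimage (continuous_conjBy φ), hφ⟩
    intro θ hθ
    have hfst : fstColoring (c.comp (φ : C(Cantor, Cantor))) = d := hcd
    rw [mem_ofPred_eq, ← hfst, pairColoring_fst_snd, ← names_conjBy]
    exact names_eq_of_mem_interior hθ
  have hdense : Dense (J ∪ (closure I)ᶜ) := by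
    intro β
    by_cases hβ : β ∈ closure I
    · exact closure_mono subset_union_left (closure_minimal hIJ isClosed_closure hβ)
    · exact subset_closure (Or.inr hβ)
  refine mem_of_superset
    (residual_of_dense_open (hJ.union isClosed_closure.isOpen_compl) hdense) ?_
  rintro β (hβ | hβ) hs hn
  · obtain ⟨d₁, h₁⟩ := mem_iUnion.1 hβ
    exact ⟨d₁, names_eq_of_mem_interior h₁⟩
  · refine absurd (subset_closure (mem_interior_iff_mem_nhds.2 ?_)) hβ
    filter_upwards [hs] with γ hγ
    exact Eq.trans hγ hn

theorem countable_stableNames [Countable G] : (stableNames G).Countable := by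
  have : SecondCountableTopology (ActSpace G) :=
    TopologicalSpace.Subtype.secondCountableTopology _
  refine countable_iUnion fun c => ?_
  refine PairwiseDisjoint.countable_of_isOpen
    (s := fun Z => interior {α : ActSpace G | names α.1 c = Z}) ?_
    (fun _ _ => isOpen_interior) (fun _ h => h)
  intro Z _ Z' _ hne
  refine disjoint_left.2 fun α h h' => hne ?_
  exact (names_eq_of_mem_interior h).symm.trans (names_eq_of_mem_interior h')

theorem mem_stableNames {α : ActSpace G} {c : C(Cantor, ℕ)} (h : α ∈ stableSet c) :
    names α.1 c ∈ stableNames G :=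
  mem_iUnion.2 ⟨c, α, mem_interior_iff_mem_nhds.2 h⟩

theorem mem_conjClass_of_generic {α β : ActSpace G} (hα : ∀ c, α ∈ stableSet c)
    (hβ : ∀ c, β ∈ stableSet c) (hα' : ∀ Z ∈ stableNames G, ∀ d, α ∈ liftingSet Z d)
    (hβ' : ∀ Z ∈ stableNames G, ∀ d, β ∈ liftingSet Z d) : β ∈ conjClass α := by
  have extend : ∀ {α β : ActSpace G}, (∀ c, α ∈ stableSet c) → (∀ c, β ∈ stableSet c) →
      (∀ Z ∈ stableNames G, ∀ d, β ∈ liftingSet Z d) → ∀ c d, names α.1 c = names β.1 d →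
      ∀ c₁, ∃ d₁, names α.1 (pairColoring c c₁) = names β.1 (pairColoring d d₁) := by
    intro α β hα hβ hβ' c d h c₁
    obtain ⟨d₁, h₁⟩ := hβ' _ (mem_stableNames (hα (pairColoring c c₁))) d (hβ d) (by
      rw [← names_fstColoring, fstColoring_pairColoring, h])
    exact ⟨d₁, h₁.symm⟩
  obtain ⟨h, -, hh⟩ := exists_conjugacy_of_back_and_forth separates_coordColoring
    separates_coordColoring α.1 β.1 1 α.2.1 β.2.1 (extend hα hβ hβ')
    (fun c d hcd d₁ => by
      obtain ⟨c₁, h₁⟩ := extend hβ hα hα' d c hcd.symm d₁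
      exact ⟨c₁, h₁.symm⟩)
    (ContinuousMap.const Cantor 0) (ContinuousMap.const Cantor 0) (by rw [names_const, names_const])
  refine ⟨h, fun g => ?_⟩
  funext x
  simp [hh]

theorem hasSTRP_of_dense_stableSet [Countable G] (h : ∀ c, Dense (stableSet (G := G) c)) :
    HasSTRP G := by
  have : Countable (stableNames G) := countable_stableNames.to_subtype
  have hR : (⋂ c, stableSet (G := G) c) ∩ ⋂ Z : stableNames G, ⋂ d, liftingSet Z.1 d ∈
      residual (ActSpace G) :=
    inter_mem (countable_iInter_mem.2 fun c => residual_of_dense_open (isOpen_stableSet c) (h c))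
      (countable_iInter_mem.2 fun Z => countable_iInter_mem.2 fun d =>
        liftingSet_mem_residual Z.2 d)
  rcases eq_empty_or_nonempty
    ((⋂ c, stableSet (G := G) c) ∩ ⋂ Z : stableNames G, ⋂ d, liftingSet Z.1 d) with he | ⟨α, hα⟩
  · rw [he] at hR
    exact ⟨⟨fun _ => ContinuousMap.id Cantor, rfl, fun _ _ => rfl⟩,
      mem_of_superset hR (empty_subset _)⟩
  · refine ⟨α, mem_of_superset hR fun β hβ => ?_⟩
    simp only [mem_inter_iff, mem_iInter, Subtype.forall] at hα hβ
    exact mem_conjClass_of_generic hα.1 hβ.1 hα.2 hβ.2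

end Generic

end

/-- For a countable group without the strong topological Rokhlin
property, the set of actions with shadowing (w.r.t. any compatible metric on the
Cantor space) is dense but meager in `Act_G(𝒞)`. -/
theorem shadowing_dense_meager_of_no_strp (G : Type) [Group G] [Countable G]
    (hstrp : ¬ HasSTRP G)
    (m : MetricSpace Cantor)
    (hcompat : m.toUniformSpace.toTopologicalSpace =
      (inferInstance : TopologicalSpace Cantor)) :
    Dense {α : ActSpace G | HasShadowing (fun x y => m.dist x y)
        (fun g z => (α.1 g) z)} ∧
    IsMeagre {α : ActSpace G | HasShadowing (fun x y => m.dist x y)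
        (fun g z => (α.1 g) z)} := by
  simp only [hasShadowing_iff m hcompat]
  refine ⟨dense_shadowsColorings, ?_⟩
  by_contra h
  exact hstrp (hasSTRP_of_dense_stableSet (dense_stableSet h))
end

section
/- Let G be a countable group and A a finite set with at least two elements. (1) Subshifts of finite type are dense in the space of subshifts of A^G: for every subshift X ⊆ A^G and every finite set F ⊆ G there exists a subshift of finite type Y ⊆ A^G with Y_F = X_F. (2) For every subshift of finite type X ⊆ A^G there exists a finite set F ⊆ G such that every subshift Y ⊆ A^G with Y_F = X_F satisfies Y ⊆ X. -/
open Topology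

/-- A set of configurations cut out by a finite window of allowed patterns is a subshift. -/
theorem IsSFT.isSubshift {G : Type} [Group G] {A : Type} {X : Set (G → A)}
    (hX : IsSFT G A X) : IsSubshift G A X := by
  obtain ⟨E, P, hP⟩ := hX
  refine ⟨?_, fun g x hx => (hP _).2 fun h => ?_⟩
  · let _ : TopologicalSpace A := ⊥
    have : DiscreteTopology A := ⟨rfl⟩
    have hX : X = ⋂ g : G, (fun (x : G → A) (e : E) => shift g x (e : G)) ⁻¹' P := by
      ext x
      simp only [hP x, Set.mem_iInter, Set.mem_preimage]
    rw [hX]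
    exact isClosed_iInter fun g => (isClosed_discrete P).preimage
      (continuous_pi fun e : E => continuous_apply (g⁻¹ * (e : G)))
  · simpa only [shift, mul_inv_rev, mul_assoc] using (hP x).1 hx (h * g)

/-- (1) Subshifts of finite type are dense in the space of subshifts;
(2) every SFT has a finite window such that subshifts with the same patterns on that
window are contained in it. -/
theorem sft_dense_and_neighborhood_basis (G : Type) [Group G] [Countable G]
    (A : Type) [Fintype A] [Nontrivial A] :
    (∀ X : Set (G → A), IsSubshift G A X → ∀ F : Finset G,
      ∃ Y : Set (G → A), IsSubshift G A Y ∧ IsSFT G A Y ∧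
        patterns F Y = patterns F X) ∧
    (∀ X : Set (G → A), IsSubshift G A X → IsSFT G A X →
      ∃ F : Finset G, ∀ Y : Set (G → A), IsSubshift G A Y →
        patterns F Y = patterns F X → Y ⊆ X) := by
  refine ⟨fun X hX F => ?_, fun X _ ⟨E, P, hP⟩ => ⟨E, fun Y hY hYX y hy => (hP y).2 fun g => ?_⟩⟩
  · have hY : IsSFT G A
        {x | ∀ g : G, (fun f : F => shift g x (f : G)) ∈ patterns F X} :=
      ⟨F, patterns F X, fun _ => Iff.rfl⟩
    refine ⟨_, hY.isSubshift, hY, Set.Subset.antisymm ?_ ?_⟩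
    · rintro _ ⟨x, hx, rfl⟩
      simpa only [shift, inv_one, one_mul] using hx 1
    · exact Set.image_mono fun x hx g => ⟨shift g x, hX.2 g x hx, rfl⟩
  · have hg : (fun e : E => shift g y (e : G)) ∈ patterns E X :=
      hYX ▸ ⟨shift g y, hY.2 g y hy, rfl⟩
    obtain ⟨x, hx, hxy⟩ := hg
    rw [← hxy]
    simpa only [shift, inv_one, one_mul] using (hP x).1 hx 1
end
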